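/- arXiv:2603.19205 — 12 statements merged into one kernel-verified Lean document; each statement's English description precedes it below -/
import Mathlib

section
/- Let G be a finite abelian group of order n and let t = |{x ∈ G : x³ = 1}| be the order of its 3-torsion subgroup. Then the number h(G) of hexagons of G satisfies 6·h(G) = n² + 3n + 2t. -/
/-- A hexagon of an abelian group `G` is an orbit of `G³` under the combined action of
`G` (by diagonal multiplication) and `S₃` (by permutation of coordinates).
`hexRel v w` says that `w` lies in the orbit of `v`. -/
def hexRel {G : Type*} [CommGroup G] (v w : G × G × G) : Prop :=
  ∃ g : G, w = (g * v.1, g * v.2.1, g * v.2.2) ∨ w = (g * v.1, g * v.2.2, g * v.2.1) ∨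
    w = (g * v.2.1, g * v.1, g * v.2.2) ∨ w = (g * v.2.1, g * v.2.2, g * v.1) ∨
    w = (g * v.2.2, g * v.1, g * v.2.1) ∨ w = (g * v.2.2, g * v.2.1, g * v.1)

/-- A subset of `G³` is a hexagon if it is the orbit of some triple. -/
def IsHexagon {G : Type*} [CommGroup G] (H : Set (G × G × G)) : Prop :=
  ∃ v : G × G × G, H = {w | hexRel v w}

/-- The number of hexagons of `G`. -/
noncomputable def numHexagons (G : Type*) [CommGroup G] : ℕ :=
  Nat.card {H : Set (G × G × G) // IsHexagon H}

open Equiv in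
/-- The combined action of `G` by left multiplication and of `S₃` by permutation of coordinates. -/
@[reducible] def tripleAction (G : Type*) [CommGroup G] :
    MulAction (G × Perm (Fin 3)) (Fin 3 → G) where
  smul p f := fun i => p.1 * f (p.2⁻¹ i)
  one_smul f := funext fun i => one_mul (f i)
  mul_smul p q f := funext fun i => by
    change (p.1 * q.1) * f ((p.2 * q.2)⁻¹ i) = p.1 * (q.1 * f (q.2⁻¹ (p.2⁻¹ i)))
    rw [mul_inv_rev, Perm.mul_apply, mul_assoc]

/-- Pairs of a group element `g` and a triple `f` such that `(g, σ)` fixes `f`. -/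
abbrev FixedPairs (G : Type*) [CommGroup G] (σ : Equiv.Perm (Fin 3)) : Type _ :=
  {p : G × (Fin 3 → G) // ∀ i, p.1 * p.2 (σ i) = p.2 i}

lemma univ_perm_fin_three : (Finset.univ : Finset (Equiv.Perm (Fin 3))) =
    {1, Equiv.swap 0 1, Equiv.swap 0 2, Equiv.swap 1 2, finRotate 3, (finRotate 3)⁻¹} := by
  decide

section
variable {G : Type*} [CommGroup G]

lemma card_fixedPairs_of_isConj {σ τ : Equiv.Perm (Fin 3)} (h : IsConj σ τ) :
    Nat.card (FixedPairs G σ) = Nat.card (FixedPairs G τ) := by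
  obtain ⟨c, rfl⟩ := isConj_iff.1 h
  refine Nat.card_congr (Equiv.subtypeEquiv
    (Equiv.prodCongr (Equiv.refl G) (Equiv.arrowCongr c (Equiv.refl G))) fun p => ?_)
  simp only [Equiv.prodCongr_apply, Prod.map, Equiv.arrowCongr_apply, Function.comp_apply,
    Equiv.refl_apply, Equiv.Perm.mul_apply, Equiv.symm_apply_apply]
  exact ⟨fun h i => h (c.symm i), fun h i => by simpa using h (c i)⟩

variable [Fintype G]

lemma card_fixedPairs_one : Nat.card (FixedPairs G 1) = Fintype.card G ^ 3 := by
  let e : FixedPairs G 1 ≃ (Fin 3 → G) :=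
    { toFun := fun p => p.1.2
      invFun := fun f => ⟨(1, f), fun i => one_mul _⟩
      left_inv := fun ⟨⟨g, f⟩, h⟩ => by
        have hg : g = 1 := by simpa using h 0
        subst hg; rfl
      right_inv := fun f => rfl }
  rw [Nat.card_congr e]
  simp

lemma card_fixedPairs_swap :
    Nat.card (FixedPairs G (Equiv.swap 0 1)) = Fintype.card G ^ 2 := by
  let e : FixedPairs G (Equiv.swap 0 1) ≃ G × G :=
    { toFun := fun p => (p.1.2 0, p.1.2 2)
      invFun := fun q => ⟨(1, ![q.1, q.1, q.2]), fun i => by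
        fin_cases i <;> simp [Equiv.swap_apply_def]⟩
      left_inv := fun ⟨⟨g, f⟩, h⟩ => by
        have hg : g = 1 := by simpa [Equiv.swap_apply_def] using h 2
        subst hg
        have h1 : f 0 = f 1 := by simpa using h 1
        ext i
        · rfl
        · fin_cases i <;> simp [h1]
      right_inv := fun q => rfl }
  rw [Nat.card_congr e]
  simp [sq]

lemma card_fixedPairs_finRotate :
    Nat.card (FixedPairs G (finRotate 3)) =
      Nat.card {x : G // x ^ 3 = 1} * Fintype.card G := by
  have r0 : finRotate 3 0 = 1 := by decide
  have r1 : finRotate 3 1 = 2 := by decide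
  have r2 : finRotate 3 2 = 0 := by decide
  let e : FixedPairs G (finRotate 3) ≃ {x : G // x ^ 3 = 1} × G :=
    { toFun := fun p => (⟨p.1.1, by
        obtain ⟨⟨g, f⟩, h⟩ := p
        have h0 : g * f 1 = f 0 := r0 ▸ h 0
        have h1 : g * f 2 = f 1 := r1 ▸ h 1
        have h2 : g * f 0 = f 2 := r2 ▸ h 2
        rw [← h1, ← h2] at h0
        apply mul_right_cancel (b := f 0)
        simpa [pow_succ, mul_assoc] using h0⟩, p.1.2 0)
      invFun := fun q => ⟨(q.1.1, ![q.2, q.1.1 * (q.1.1 * q.2), q.1.1 * q.2]), by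
        obtain ⟨⟨g, hg⟩, x⟩ := q
        intro i
        fin_cases i
        · change g * ![x, g * (g * x), g * x] (finRotate 3 0) = x
          rw [r0]
          change g * (g * (g * x)) = x
          rw [← mul_assoc, ← mul_assoc, ← pow_three', hg, one_mul]
        · change g * ![x, g * (g * x), g * x] (finRotate 3 1) = g * (g * x)
          rw [r1]
          rfl
        · change g * ![x, g * (g * x), g * x] (finRotate 3 2) = g * x
          rw [r2]
          rfl⟩
      left_inv := fun ⟨⟨g, f⟩, h⟩ => by
        have h1 : g * f 2 = f 1 := r1 ▸ h 1
        have h2 : g * f 0 = f 2 := r2 ▸ h 2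
        ext i
        · rfl
        · fin_cases i <;> simp [h1, h2]
      right_inv := fun q => rfl }
  rw [Nat.card_congr e, Nat.card_prod, Nat.card_eq_fintype_card (α := G)]

lemma sum_card_fixedPairs :
    ∑ σ, Nat.card (FixedPairs G σ) =
      Fintype.card G ^ 3 + 3 * Fintype.card G ^ 2 +
        2 * (Nat.card {x : G // x ^ 3 = 1} * Fintype.card G) := by
  have h02 : IsConj (Equiv.swap (0 : Fin 3) 2) (Equiv.swap 0 1) := by
    rw [isConj_iff]; decide
  have h12 : IsConj (Equiv.swap (1 : Fin 3) 2) (Equiv.swap 0 1) := by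
    rw [isConj_iff]; decide
  have hr : IsConj (finRotate 3)⁻¹ (finRotate 3) := by
    rw [isConj_iff]; decide
  rw [univ_perm_fin_three]
  repeat rw [Finset.sum_insert (by decide)]
  rw [Finset.sum_singleton, card_fixedPairs_of_isConj h02, card_fixedPairs_of_isConj h12,
    card_fixedPairs_of_isConj hr, card_fixedPairs_one, card_fixedPairs_swap,
    card_fixedPairs_finRotate]
  ring

end

lemma hexRel_iff_mem_orbit {G : Type*} [CommGroup G] (f : Fin 3 → G) (w : G × G × G) :
    hexRel (f 0, f 1, f 2) w ↔
      letI := tripleAction G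
      ![w.1, w.2.1, w.2.2] ∈ MulAction.orbit (G × Equiv.Perm (Fin 3)) f := by
  let := tripleAction G
  have key : ∀ (g : G) (σ : Equiv.Perm (Fin 3)), (g, σ⁻¹) • f = ![w.1, w.2.1, w.2.2] ↔
      w = (g * f (σ 0), g * f (σ 1), g * f (σ 2)) := by
    intro g σ
    have hs : (g, σ⁻¹) • f = fun i => g * f (σ i) := by
      funext i
      change g * f (σ⁻¹⁻¹ i) = _
      rw [inv_inv]
    obtain ⟨x, y, z⟩ := w
    rw [hs, funext_iff, Fin.forall_fin_succ, Fin.forall_fin_two]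
    simp only [Prod.mk.injEq]
    exact ⟨fun h => ⟨h.1.symm, h.2.1.symm, h.2.2.symm⟩,
      fun h => ⟨h.1.symm, h.2.1.symm, h.2.2.symm⟩⟩
  have horb : ![w.1, w.2.1, w.2.2] ∈ MulAction.orbit (G × Equiv.Perm (Fin 3)) f ↔
      ∃ g : G, ∃ σ ∈ (Finset.univ : Finset (Equiv.Perm (Fin 3))),
        w = (g * f (σ 0), g * f (σ 1), g * f (σ 2)) := by
    constructor
    · rintro ⟨⟨g, σ⟩, h⟩
      exact ⟨g, σ⁻¹, Finset.mem_univ _, (key g σ⁻¹).1 (by rw [inv_inv]; exact h)⟩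
    · rintro ⟨g, σ, -, h⟩
      exact ⟨(g, σ⁻¹), (key g σ).2 h⟩
  have r0 : finRotate 3 0 = 1 := by decide
  have r1 : finRotate 3 1 = 2 := by decide
  have r2 : finRotate 3 2 = 0 := by decide
  have s0 : (finRotate 3)⁻¹ 0 = 2 := by decide
  have s1 : (finRotate 3)⁻¹ 1 = 0 := by decide
  have s2 : (finRotate 3)⁻¹ 2 = 1 := by decide
  have t012 : Equiv.swap (0 : Fin 3) 1 2 = 2 := by decide
  have t021 : Equiv.swap (0 : Fin 3) 2 1 = 1 := by decide
  have t120 : Equiv.swap (1 : Fin 3) 2 0 = 0 := by decide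
  rw [horb, univ_perm_fin_three, hexRel]
  simp only [Finset.mem_insert, Finset.mem_singleton, exists_eq_or_imp, exists_eq_left,
    Equiv.Perm.one_apply, Equiv.swap_apply_left, Equiv.swap_apply_right,
    r0, r1, r2, s0, s1, s2, t012, t021, t120]
  refine exists_congr fun g => ?_
  tauto

lemma numHexagons_eq_card_orbits (G : Type*) [CommGroup G] :
    letI := tripleAction G
    numHexagons G =
      Nat.card (MulAction.orbitRel.Quotient (G × Equiv.Perm (Fin 3)) (Fin 3 → G)) := by
  let := tripleAction G
  let F : (Fin 3 → G) → Set (G × G × G) := fun f => {w | hexRel (f 0, f 1, f 2) w}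
  have hF : ∀ f f', F f = F f' ↔
      MulAction.orbitRel (G × Equiv.Perm (Fin 3)) (Fin 3 → G) f f' := by
    intro f f'
    rw [MulAction.orbitRel_apply, ← MulAction.orbit_eq_iff]
    have hv : ∀ v : Fin 3 → G, ![v 0, v 1, v 2] = v := fun v => by
      ext i; fin_cases i <;> rfl
    simp only [F, Set.ext_iff, Set.mem_ofPred_eq, hexRel_iff_mem_orbit]
    exact ⟨fun h v => by simpa only [hv] using h (v 0, v 1, v 2), fun h w => h _⟩
  have hker : Setoid.ker F = MulAction.orbitRel (G × Equiv.Perm (Fin 3)) (Fin 3 → G) :=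
    Setoid.ext hF
  have hrange : Set.range F = {H | IsHexagon H} := by
    ext H
    constructor
    · rintro ⟨f, rfl⟩
      exact ⟨_, rfl⟩
    · rintro ⟨v, rfl⟩
      exact ⟨![v.1, v.2.1, v.2.2], rfl⟩
  change Nat.card {H | IsHexagon H} = Nat.card (Quotient (MulAction.orbitRel _ _))
  rw [← hrange, ← hker]
  exact (Nat.card_congr (Setoid.quotientKerEquivRange F)).symm

/-- for a finite abelian group `G` of order `n` with 3-torsion subgroup of
order `t`, we have `6 h(G) = n² + 3n + 2t`. -/
theorem stmt0 (G : Type*) [CommGroup G] [Fintype G] :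
    6 * numHexagons G =
      Fintype.card G ^ 2 + 3 * Fintype.card G + 2 * Nat.card {x : G // x ^ 3 = 1} := by
  classical
  let := tripleAction G
  have burnside := Nat.card_congr
    (MulAction.sigmaFixedByEquivOrbitsProdGroup (G × Equiv.Perm (Fin 3)) (Fin 3 → G))
  let e : (Σ p : G × Equiv.Perm (Fin 3), MulAction.fixedBy (Fin 3 → G) p) ≃
      Σ σ, FixedPairs G σ :=
    { toFun := fun x => ⟨x.1.2⁻¹, (x.1.1, x.2.1), fun i => congrFun x.2.2 i⟩
      invFun := fun y => ⟨(y.2.1.1, y.1⁻¹), y.2.1.2, funext fun i => by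
        change y.2.1.1 * y.2.1.2 (y.1⁻¹⁻¹ i) = _
        rw [inv_inv]
        exact y.2.2 i⟩
      left_inv := fun ⟨⟨g, σ⟩, f⟩ => rfl
      right_inv := fun ⟨σ, p⟩ => rfl }
  rw [Nat.card_congr e, Nat.card_sigma, sum_card_fixedPairs, Nat.card_prod, Nat.card_prod,
    ← numHexagons_eq_card_orbits, Nat.card_eq_fintype_card (α := G),
    Nat.card_eq_fintype_card (α := Equiv.Perm (Fin 3)), Fintype.card_perm, Fintype.card_fin,
    show Nat.factorial 3 = 6 from rfl] at burnside
  refine Nat.eq_of_mul_eq_mul_right (Fintype.card_pos (α := G)) ?_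
  linarith
end

section
/- Let G be a finite abelian group of order n. Then the number of group homomorphisms G → G is at most n^{⌊log₂ n⌋}. -/
theorem Subgroup.two_mul_card_le_of_lt {G : Type*} [Group G] [Finite G] {H K : Subgroup G}
    (h : H < K) : 2 * Nat.card H ≤ Nat.card K := by
  obtain ⟨c, hc⟩ := Subgroup.card_dvd_of_le h.le
  have hlt : Nat.card H < Nat.card K := Set.Finite.card_lt_card (Set.toFinite _) h
  have hc2 : 2 ≤ c := by
    by_contra! hcon
    interval_cases c <;> omega
  rw [hc, mul_comm]
  exact Nat.mul_le_mul_left _ hc2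

/-- A finite group has a generating set of size at most the base-2 logarithm of its order. -/
theorem Group.exists_closure_eq_top_two_pow_card_le (G : Type*) [Group G] [Finite G] :
    ∃ S : Finset G, Subgroup.closure (S : Set G) = ⊤ ∧ 2 ^ S.card ≤ Nat.card G := by
  classical
  have := Fintype.ofFinite G
  obtain ⟨S, hS, hmax⟩ := Finset.exists_max_image
    ({S : Finset G | 2 ^ S.card ≤ Nat.card (Subgroup.closure (S : Set G))} : Finset (Finset G))
    Finset.card ⟨∅, by simp⟩
  simp only [Finset.mem_filter, Finset.mem_univ, true_and] at hS hmax
  refine ⟨S, ?_, hS.trans (Subgroup.card_le_card_group _)⟩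
  by_contra hne
  obtain ⟨g, hg⟩ : ∃ g, g ∉ Subgroup.closure (S : Set G) := by
    simpa [Subgroup.eq_top_iff'] using hne
  have hgS : g ∉ S := fun h => hg (Subgroup.subset_closure h)
  have hlt : Subgroup.closure (S : Set G) <
      Subgroup.closure ((insert g S : Finset G) : Set G) := by
    refine lt_of_le_of_ne (Subgroup.closure_mono (by simp)) fun h => hg ?_
    rw [h]
    exact Subgroup.subset_closure (by simp)
  have hcard := Subgroup.two_mul_card_le_of_lt hlt
  have := hmax (insert g S) (by rw [Finset.card_insert_of_notMem hgS, pow_succ]; omega)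
  rw [Finset.card_insert_of_notMem hgS] at this
  omega

theorem MonoidHom.card_le_pow_of_closure_eq_top {G H : Type*} [Group G] [Group H] [Finite H]
    {S : Finset G} (hS : Subgroup.closure (S : Set G) = ⊤) :
    Nat.card (G →* H) ≤ Nat.card H ^ S.card := by
  have hinj : Function.Injective fun (f : G →* H) (s : S) => f s := fun f f' h =>
    MonoidHom.eq_of_eqOn_dense hS fun s hs => congrFun h ⟨s, hs⟩
  simpa [Nat.card_fun] using Nat.card_le_card_of_injective _ hinj

/-- a finite abelian group `G` of order `n` has at most `n ^ ⌊log₂ n⌋`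
endomorphisms. -/
theorem stmt1 (G : Type*) [CommGroup G] [Fintype G] :
    Nat.card (G →* G) ≤ Fintype.card G ^ Nat.log 2 (Fintype.card G) := by
  obtain ⟨S, hS, hcard⟩ := Group.exists_closure_eq_top_two_pow_card_le G
  rw [← Nat.card_eq_fintype_card]
  exact (MonoidHom.card_le_pow_of_closure_eq_top hS).trans
    (Nat.pow_le_pow_right Nat.card_pos (Nat.le_log_of_pow_le one_lt_two hcard))
end

section
/- Let G be a finite nonabelian group of order n. Then 8·∑_{g ∈ G} |C_G(g)|² ≤ 5n³, where C_G(g) denotes the centralizer of g in G. -/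
open scoped BigOperators

/-- A proper subgroup of a finite group has at most half of its elements. -/
theorem Subgroup.two_mul_card_le_of_ne_top {G : Type*} [Group G] [Finite G] {H : Subgroup G}
    (hH : H ≠ ⊤) : 2 * Nat.card H ≤ Nat.card G := by
  have h1 : H.index ≠ 1 := fun h => hH (Subgroup.index_eq_one.mp h)
  have h0 : H.index ≠ 0 := Subgroup.index_ne_zero_of_finite
  rw [← H.card_mul_index, mul_comm]
  exact Nat.mul_le_mul_left _ (by omega)

theorem Subgroup.four_mul_card_centralizer_sq_le {G : Type*} [Group G] [Finite G] (g : G)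
    [Decidable (g ∈ Subgroup.center G)] :
    4 * Nat.card (Subgroup.centralizer ({g} : Set G)) ^ 2 ≤
      Nat.card G ^ 2 + if g ∈ Subgroup.center G then 3 * Nat.card G ^ 2 else 0 := by
  split_ifs with hg
  · have := Nat.pow_le_pow_left (Subgroup.card_le_card_group (Subgroup.centralizer ({g} : Set G))) 2
    omega
  · have hne : Subgroup.centralizer ({g} : Set G) ≠ ⊤ := fun h =>
      hg (by simpa using Subgroup.centralizer_eq_top_iff_subset.mp h)
    have := Nat.pow_le_pow_left (Subgroup.two_mul_card_le_of_ne_top hne) 2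
    rw [mul_pow] at this
    omega

/-- for a finite nonabelian group `G` of order `n`,
`8 · ∑_{g ∈ G} |C_G(g)|² ≤ 5 n³`. -/
theorem stmt3 (G : Type*) [Group G] [Fintype G] (hG : ∃ a b : G, a * b ≠ b * a) :
    8 * ∑ g : G, Nat.card (Subgroup.centralizer ({g} : Set G)) ^ 2 ≤
      5 * Fintype.card G ^ 3 := by
  classical
  obtain ⟨a, b, hab⟩ := hG
  have hne : Subgroup.center G ≠ ⊤ := fun h =>
    hab (Subgroup.mem_center_iff.mp (h ▸ Subgroup.mem_top b) a)
  have hZ := Subgroup.two_mul_card_le_of_ne_top hne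
  have hsum := Finset.sum_le_sum fun (g : G) (_ : g ∈ Finset.univ) =>
    Subgroup.four_mul_card_centralizer_sq_le g
  have hcard : (Finset.univ.filter (· ∈ Subgroup.center G)).card =
      Nat.card (Subgroup.center G) := by
    rw [Nat.card_eq_fintype_card, Fintype.card_subtype]
  rw [← Finset.mul_sum, Finset.sum_add_distrib, ← Finset.sum_filter, Finset.sum_const,
    Finset.sum_const, Finset.card_univ, hcard, smul_eq_mul, smul_eq_mul] at hsum
  rw [Nat.card_eq_fintype_card (α := G)] at hZ hsum
  nlinarith [Nat.mul_le_mul_right (Fintype.card G ^ 2) hZ]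
end

section
/- Let F be a division ring and let Γ be a proper subgroup of the multiplicative group Fˣ of finite index k = [Fˣ : Γ]. If Fˣ is infinite or |Fˣ| > k⁴, then Γ − Γ = F; that is, every element of F can be written as γ₁ − γ₂ with γ₁, γ₂ ∈ Γ. -/
/-- In an infinite division ring, the number of pairwise disjoint translates `x i + Γ` of a
subgroup `Γ` of finite index in `Fˣ` is at most the index. -/
theorem card_le_index_of_disjoint_translates {F : Type*} [DivisionRing F] [Infinite F]
    (Γ : Subgroup Fˣ) [Finite (Fˣ ⧸ Γ)] {n : ℕ} (x : Fin n → F)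
    (hx : ∀ i j, ∀ γ ∈ Γ, ∀ δ ∈ Γ, x i + (γ : F) = x j + (δ : F) → i = j) :
    n ≤ Γ.index := by
  classical
  have := Fintype.ofFinite (Fˣ ⧸ Γ)
  rcases Nat.eq_zero_or_pos n with rfl | hn
  · exact Nat.zero_le _
  have : Nonempty (Fin n) := ⟨⟨0, hn⟩⟩
  let z : ((Fˣ ⧸ Γ) → Fin n) → F := fun f => ∑ c, (c.out : F) * x (f c)
  obtain ⟨w, hw⟩ := Infinite.exists_notMem_finset (Finset.univ.image z)
  have hne : ∀ f, w - z f ≠ 0 := fun f h =>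
    hw (Finset.mem_image.2 ⟨f, Finset.mem_univ f, (sub_eq_zero.1 h).symm⟩)
  let col : ((Fˣ ⧸ Γ) → Fin n) → Fˣ ⧸ Γ := fun f => (Units.mk0 _ (hne f) : Fˣ)
  have hcol : ∀ f, ∃ γ ∈ Γ, w - z f = ((col f).out : F) * (γ : F) := by
    intro f
    refine ⟨(col f).out⁻¹ * Units.mk0 _ (hne f), ?_, by simp⟩
    rw [← QuotientGroup.eq, QuotientGroup.out_eq']
  have hinj : Function.Injective
      (fun p : ((Fˣ ⧸ Γ) → Fin n) × Fin n => (col p.1, Function.update p.1 (col p.1) p.2)) := by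
    rintro ⟨f, i⟩ ⟨g, j⟩ h
    obtain ⟨hc, hu⟩ := Prod.mk.inj h
    simp only at hc hu
    rw [← hc] at hu
    have hij : i = j := by simpa using congrFun hu (col f)
    have hoff : ∀ d ≠ col f, f d = g d := fun d hd => by simpa [hd] using congrFun hu d
    obtain ⟨γ, hγ, hfγ⟩ := hcol f
    obtain ⟨δ, hδ, hgδ⟩ := hcol g
    rw [← hc] at hgδ
    have hsum : ∀ f' : (Fˣ ⧸ Γ) → Fin n, z f' = ((col f).out : F) * x (f' (col f)) +
        ∑ d ∈ Finset.univ.erase (col f), (d.out : F) * x (f' d) := fun f' =>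
      (Finset.add_sum_erase _ _ (Finset.mem_univ _)).symm
    have hrest : ∑ d ∈ Finset.univ.erase (col f), (d.out : F) * x (f d) =
        ∑ d ∈ Finset.univ.erase (col f), (d.out : F) * x (g d) :=
      Finset.sum_congr rfl fun d hd => by rw [hoff d (Finset.ne_of_mem_erase hd)]
    have hat : f (col f) = g (col f) := by
      refine hx _ _ γ hγ δ hδ (mul_left_cancel₀ (Units.ne_zero (col f).out) ?_)
      rw [mul_add, mul_add, ← hfγ, ← hgδ, hsum f, hsum g, hrest]
      abel
    refine Prod.ext (funext fun d => ?_) hij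
    by_cases hd : d = col f
    · rw [hd]; exact hat
    · exact hoff d hd
  have hcard := Fintype.card_le_of_injective _ hinj
  rw [Fintype.card_prod, Fintype.card_prod, mul_comm, Fintype.card_fin] at hcard
  rw [Subgroup.index, Nat.card_eq_fintype_card]
  exact Nat.le_of_mul_le_mul_right hcard Fintype.card_pos

/-- Ramsey's theorem for the differences of a sequence: in an infinite division ring some
sequence has all its differences `x j - x i`, `i < j`, in a single coset of `Γ`. -/
theorem exists_seq_sub_mem_coset {F : Type*} [DivisionRing F] [Infinite F]
    (Γ : Subgroup Fˣ) [Finite (Fˣ ⧸ Γ)] :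
    ∃ (c : Fˣ ⧸ Γ) (x : ℕ → F), ∀ i j, i < j →
      ∃ u : Fˣ, (u : Fˣ ⧸ Γ) = c ∧ x j - x i = u := by
  let U := Filter.hyperfilter F
  have h₁ : ∀ x : F, ∃ c : Fˣ ⧸ Γ, ∀ᶠ y in U, ∃ u : Fˣ, (u : Fˣ ⧸ Γ) = c ∧ y - x = u := by
    intro x
    rw [← Ultrafilter.eventually_exists_iff]
    have hx : ∀ᶠ y in U, y ≠ x := by
      refine Filter.hyperfilter_le_cofinite ?_
      simp
    filter_upwards [hx] with y hy
    exact ⟨_, Units.mk0 _ (sub_ne_zero.2 hy), rfl, rfl⟩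
  choose col hcol using h₁
  obtain ⟨c, hc⟩ : ∃ c, ∀ᶠ x in U, col x = c := by
    rw [← Ultrafilter.eventually_exists_iff]
    exact Filter.Eventually.of_forall fun x => ⟨_, rfl⟩
  obtain ⟨x, -, hx⟩ := exists_seq_of_forall_finset_exists (fun x => col x = c)
    (fun x y => ∃ u : Fˣ, (u : Fˣ ⧸ Γ) = c ∧ y - x = u) (by
      intro s hs
      have : ∀ᶠ y in U, ∀ x ∈ s, ∃ u : Fˣ, (u : Fˣ ⧸ Γ) = c ∧ y - x = u :=
        (Filter.eventually_all_finset s).2 fun x hxs => hs x hxs ▸ hcol x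
      exact (hc.and this).exists)
  exact ⟨c, x, hx⟩

theorem units_mem_sub_of_infinite {F : Type*} [DivisionRing F] [Infinite F]
    (Γ : Subgroup Fˣ) [Finite (Fˣ ⧸ Γ)] (a : Fˣ) :
    ∃ γ ∈ Γ, ∃ δ ∈ Γ, (a : F) = (γ : F) - (δ : F) := by
  by_contra hcon
  obtain ⟨c, x, hx⟩ := exists_seq_sub_mem_coset Γ
  obtain ⟨b, rfl⟩ := QuotientGroup.mk_surjective c
  have key : ∀ i j : ℕ, i < j → ∀ γ ∈ Γ, ∀ δ ∈ Γ,
      ((a * b⁻¹ : Fˣ) : F) * x j + (γ : F) ≠ ((a * b⁻¹ : Fˣ) : F) * x i + (δ : F) := by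
    intro i j hij γ hγ δ hδ h
    obtain ⟨u, hu, hxu⟩ := hx i j hij
    have hε : b⁻¹ * u ∈ Γ := QuotientGroup.eq.1 hu.symm
    have hd : (a : F) * ((b⁻¹ * u : Fˣ) : F) = (δ : F) - (γ : F) := by
      rw [eq_sub_iff_add_eq, Units.val_mul, ← mul_assoc, ← Units.val_mul, ← hxu, mul_sub,
        sub_add_eq_add_sub, h]
      abel
    refine hcon ⟨δ * (b⁻¹ * u)⁻¹, mul_mem hδ (inv_mem hε), γ * (b⁻¹ * u)⁻¹,
      mul_mem hγ (inv_mem hε), ?_⟩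
    rw [Units.val_mul, Units.val_mul, ← sub_mul, ← hd, mul_assoc, Units.mul_inv, mul_one]
  have := card_le_index_of_disjoint_translates Γ (n := Γ.index + 1)
    (fun i => ((a * b⁻¹ : Fˣ) : F) * x i) (by
      intro i j γ hγ δ hδ h
      rcases lt_trichotomy (i : ℕ) j with hij | hij | hij
      · exact absurd h.symm (key _ _ hij δ hδ γ hγ)
      · exact Fin.ext hij
      · exact absurd h (key _ _ hij γ hγ δ hδ))
  omega

section Finite

variable {F : Type*} [DivisionRing F] [Fintype F]

open Classical in
/-- The number of `γ ∈ Γ` such that `x - γ` lies in the coset `c`. -/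
noncomputable def cosetRep (Γ : Subgroup Fˣ) (c : Fˣ ⧸ Γ) (x : F) : ℝ :=
  ∑ γ : Γ, if ∃ u : Fˣ, (u : Fˣ ⧸ Γ) = c ∧ x - ((γ : Fˣ) : F) = u then 1 else 0

open Classical in
theorem sq_card_le_sum_cosetRep (Γ : Subgroup Fˣ) (c : Fˣ ⧸ Γ) :
    (Nat.card Γ : ℝ) ^ 2 ≤ ∑ x, cosetRep Γ c x := by
  obtain ⟨v, rfl⟩ := QuotientGroup.mk_surjective c
  have h : ∀ γ : Γ, (Nat.card Γ : ℝ) ≤ ∑ x : F,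
      if ∃ u : Fˣ, (u : Fˣ ⧸ Γ) = v ∧ x - ((γ : Fˣ) : F) = u then (1 : ℝ) else 0 := by
    intro γ
    rw [Finset.sum_boole, Nat.card_eq_fintype_card, ← Finset.card_univ, Nat.cast_le]
    refine Finset.card_le_card_of_injOn
      (fun δ : Γ => ((v * δ : Fˣ) : F) + ((γ : Fˣ) : F)) ?_ ?_
    · intro δ _
      simp only [Finset.coe_filter, Finset.mem_univ, true_and, Set.mem_ofPred_eq]
      exact ⟨v * δ, QuotientGroup.mk_mul_of_mem _ δ.2, add_sub_cancel_right _ _⟩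
    · intro δ _ δ' _ h
      exact Subtype.ext (mul_left_cancel (Units.ext (add_right_cancel h)))
  simp only [cosetRep]
  rw [Finset.sum_comm]
  refine le_trans ?_ (Finset.sum_le_sum fun γ _ => h γ)
  simp [sq]

open Classical in
theorem sum_sum_cosetRep_sq_le (Γ : Subgroup Fˣ) :
    ∑ c, ∑ x, cosetRep Γ c x ^ 2 ≤
      (Nat.card Γ : ℝ) * ((Nat.card Fˣ : ℝ) + ((Nat.card Γ : ℝ) - 1) ^ 2) := by
  let P : Γ → (Fˣ ⧸ Γ) × F → Prop := fun γ p =>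
    ∃ u : Fˣ, (u : Fˣ ⧸ Γ) = p.1 ∧ p.2 - ((γ : Fˣ) : F) = u
  have hdiag : ∀ γ : Γ, (Finset.univ.filter fun p => P γ p ∧ P γ p).card ≤ Nat.card Fˣ := by
    intro γ
    rw [Nat.card_eq_fintype_card, ← Finset.card_univ]
    refine Finset.card_le_card_of_surjOn (fun u : Fˣ => ((u : Fˣ ⧸ Γ), (u : F) + ((γ : Fˣ) : F))) ?_
    rintro ⟨c, x⟩ h
    simp only [Finset.coe_filter, Finset.mem_univ, true_and, Set.mem_ofPred_eq, and_self] at h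
    obtain ⟨u, hu, hxu⟩ := h
    exact ⟨u, by simp, Prod.ext hu (by simp [← hxu])⟩
  have hoff : ∀ γ δ : Γ, γ ≠ δ →
      (Finset.univ.filter fun p => P γ p ∧ P δ p).card ≤ Nat.card Γ - 1 := by
    intro γ δ hne
    have hne' : ((γ : Fˣ) : F) ≠ ((δ : Fˣ) : F) := fun h => hne (Subtype.ext (Units.ext h))
    have hcard : Nat.card Γ - 1 = (Finset.univ.erase (1 : Γ)).card := by
      rw [Finset.card_erase_of_mem (Finset.mem_univ _), Finset.card_univ,
        Nat.card_eq_fintype_card]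
    rw [hcard]
    have hex : ∀ p : (Fˣ ⧸ Γ) × F, P γ p ∧ P δ p → ∃ ε : Γ,
        p.2 - ((γ : Fˣ) : F) = (p.2 - ((δ : Fˣ) : F)) * ((ε : Fˣ) : F) := by
      rintro p ⟨⟨u, hu, hxu⟩, ⟨v, hv, hxv⟩⟩
      refine ⟨⟨v⁻¹ * u, QuotientGroup.eq.1 (hv.trans hu.symm)⟩, ?_⟩
      rw [hxu, hxv, ← Units.val_mul, mul_inv_cancel_left]
    have hex' : ∀ p : (Fˣ ⧸ Γ) × F, ∃ ε : Γ, P γ p ∧ P δ p →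
        p.2 - ((γ : Fˣ) : F) = (p.2 - ((δ : Fˣ) : F)) * ((ε : Fˣ) : F) := by
      intro p
      by_cases hp : P γ p ∧ P δ p
      · obtain ⟨ε, hε⟩ := hex p hp
        exact ⟨ε, fun _ => hε⟩
      · exact ⟨1, fun h => absurd h hp⟩
    choose e he using hex'
    refine Finset.card_le_card_of_injOn e ?_ ?_
    · intro p hp
      simp only [Finset.coe_filter, Finset.mem_univ, true_and, Set.mem_ofPred_eq] at hp
      have h := he p hp
      simp only [Finset.coe_erase, Finset.coe_univ, Set.mem_sdiff, Set.mem_univ,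
        Set.mem_singleton_iff, true_and]
      intro h1
      rw [h1] at h
      apply hne'
      simpa using h
    · rintro ⟨c, x⟩ hp ⟨d, y⟩ hq h
      simp only [Finset.coe_filter, Finset.mem_univ, true_and, Set.mem_ofPred_eq] at hp hq
      have h1 := he _ hp
      have h2 := he _ hq
      simp only at h1 h2
      rw [← h] at h2
      have hε : ((e (c, x) : Fˣ) : F) ≠ 1 := by
        intro h3
        rw [h3, mul_one] at h1
        exact hne' (sub_right_injective h1)
      have hxy : x = y := by
        have h3 : (x - y) * (((e (c, x) : Fˣ) : F) - 1) = 0 := by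
          have h4 : x - y = (x - y) * ((e (c, x) : Fˣ) : F) := by
            calc x - y = (x - ((γ : Fˣ) : F)) - (y - ((γ : Fˣ) : F)) := by abel
              _ = _ := by rw [h1, h2, ← sub_mul]; congr 1; abel
          rw [mul_sub, mul_one, ← h4, sub_self]
        exact sub_eq_zero.1 ((mul_eq_zero.1 h3).resolve_right (sub_ne_zero.2 hε))
      subst hxy
      obtain ⟨⟨u, hu, hxu⟩, -⟩ := hp
      obtain ⟨⟨v, hv, hxv⟩, -⟩ := hq
      have huv : u = v := Units.ext (hxu.symm.trans hxv)
      exact Prod.ext (by rw [← hu, ← hv, huv]) rfl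
  have hexp : ∑ c, ∑ x, cosetRep Γ c x ^ 2 =
      ∑ γ : Γ, ∑ δ : Γ, ((Finset.univ.filter fun p => P γ p ∧ P δ p).card : ℝ) := by
    rw [← Fintype.sum_prod_type' (fun c x => cosetRep Γ c x ^ 2)]
    simp only [cosetRep, sq, Finset.sum_mul_sum, ← Finset.sum_boole]
    rw [Finset.sum_comm]
    refine Finset.sum_congr rfl fun γ _ => ?_
    rw [Finset.sum_comm]
    refine Finset.sum_congr rfl fun δ _ => Finset.sum_congr rfl fun p _ => ?_
    rw [ite_zero_mul_ite_zero, mul_one]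
  have hrow : ∀ γ : Γ, ∑ δ : Γ, ((Finset.univ.filter fun p => P γ p ∧ P δ p).card : ℝ) ≤
      (Nat.card Fˣ : ℝ) + ((Nat.card Γ : ℝ) - 1) ^ 2 := by
    intro γ
    rw [← Finset.add_sum_erase _ _ (Finset.mem_univ γ)]
    have hpos : 1 ≤ Nat.card Γ := Nat.card_pos
    refine add_le_add (by exact_mod_cast hdiag γ) ?_
    have := Finset.sum_le_card_nsmul (Finset.univ.erase γ)
      (fun δ => ((Finset.univ.filter fun p => P γ p ∧ P δ p).card : ℝ)) ((Nat.card Γ : ℝ) - 1) (by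
        intro δ hδ
        rw [← Nat.cast_one, ← Nat.cast_sub hpos, Nat.cast_le]
        exact hoff γ δ (Finset.ne_of_mem_erase hδ).symm)
    refine this.trans_eq ?_
    rw [Finset.card_erase_of_mem (Finset.mem_univ _), Finset.card_univ,
      ← Nat.card_eq_fintype_card, nsmul_eq_mul, Nat.cast_sub hpos, Nat.cast_one, sq]
  rw [hexp]
  refine (Finset.sum_le_sum fun γ _ => hrow γ).trans_eq ?_
  simp [mul_add]

open Classical in
/-- If `Γ` has no difference equal to `a`, then `cosetRep Γ a` vanishes on `Γ`, and two applications of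
Cauchy-Schwarz contradict the second moment bound `sum_sum_cosetRep_sq_le`. -/
theorem units_mem_sub_of_finite (Γ : Subgroup Fˣ) (h : Γ.index ^ 4 < Nat.card Fˣ) (a : Fˣ) :
    ∃ γ ∈ Γ, ∃ δ ∈ Γ, (a : F) = (γ : F) - (δ : F) := by
  by_contra hcon
  have hkm : Nat.card Γ * Γ.index = Nat.card Fˣ := Γ.card_mul_index
  have hq : Fintype.card F = Nat.card Fˣ + 1 := by
    rw [Nat.card_eq_fintype_card, Fintype.card_units]
    have : 0 < Fintype.card F := Fintype.card_pos
    omega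
  have hm : 0 < Nat.card Γ := Nat.card_pos
  have hk : 0 < Γ.index := Nat.pos_of_ne_zero Subgroup.index_ne_zero_of_finite
  have hidx : Fintype.card (Fˣ ⧸ Γ) = Γ.index := by
    rw [Subgroup.index, Nat.card_eq_fintype_card]
  have htot := sum_sum_cosetRep_sq_le Γ
  have hsum := sq_card_le_sum_cosetRep Γ
  generalize hmdef : Nat.card Γ = m at *
  generalize hkdef : Γ.index = k at *
  have hmk : k ^ 3 < m := by
    rw [← hkm, pow_succ] at h
    exact lt_of_mul_lt_mul_right h (Nat.zero_le _)
  have hgen : ∀ c, (m : ℝ) ^ 4 ≤ (m * k + 1) * ∑ x, cosetRep Γ c x ^ 2 := by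
    intro c
    have h1 := sq_sum_le_card_mul_sum_sq (s := Finset.univ) (f := fun x => cosetRep Γ c x)
    rw [Finset.card_univ, hq, ← hkm] at h1
    push_cast at h1
    refine le_trans ?_ h1
    calc (m : ℝ) ^ 4 = ((m : ℝ) ^ 2) ^ 2 := by ring
      _ ≤ _ := by gcongr; exact hsum c
  let S : Finset F := Finset.univ.image fun γ : Γ => ((γ : Fˣ) : F)
  have hS : S.card = m := by
    rw [Finset.card_image_of_injective _ (fun γ δ h => Subtype.ext (Units.ext h)),
      Finset.card_univ, ← hmdef, Nat.card_eq_fintype_card]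
  have hzero : ∀ x ∈ S, cosetRep Γ (a : Fˣ ⧸ Γ) x = 0 := by
    intro x hx
    obtain ⟨γ, -, rfl⟩ := Finset.mem_image.1 hx
    refine Finset.sum_eq_zero fun δ _ => if_neg ?_
    rintro ⟨u, hu, hxu⟩
    have hε : a⁻¹ * u ∈ Γ := QuotientGroup.eq.1 hu.symm
    refine hcon ⟨γ * (a⁻¹ * u)⁻¹, mul_mem γ.2 (inv_mem hε), δ * (a⁻¹ * u)⁻¹,
      mul_mem δ.2 (inv_mem hε), ?_⟩
    rw [Units.val_mul, Units.val_mul, ← sub_mul, hxu, ← Units.val_mul]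
    simp
  have hspec : (m : ℝ) ^ 4 ≤ (m * k + 1 - m) * ∑ x, cosetRep Γ (a : Fˣ ⧸ Γ) x ^ 2 := by
    have h1 := sq_sum_le_card_mul_sum_sq (s := Sᶜ) (f := fun x => cosetRep Γ (a : Fˣ ⧸ Γ) x)
    have h2 : ∑ x ∈ Sᶜ, cosetRep Γ (a : Fˣ ⧸ Γ) x = ∑ x, cosetRep Γ (a : Fˣ ⧸ Γ) x :=
      Finset.sum_subset (Finset.subset_univ _) fun x _ hx => hzero x (by simpa using hx)
    have h3 : ∑ x ∈ Sᶜ, cosetRep Γ (a : Fˣ ⧸ Γ) x ^ 2 = ∑ x, cosetRep Γ (a : Fˣ ⧸ Γ) x ^ 2 :=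
      Finset.sum_subset (Finset.subset_univ _) fun x _ hx => by
        rw [hzero x (by simpa using hx)]; simp
    have h4 : (Sᶜ.card : ℝ) = m * k + 1 - m := by
      rw [Finset.card_compl, Nat.cast_sub (Finset.card_le_univ _), hS, hq, ← hkm]
      push_cast
      ring
    rw [h2, h3, h4] at h1
    refine le_trans ?_ h1
    calc (m : ℝ) ^ 4 = ((m : ℝ) ^ 2) ^ 2 := by ring
      _ ≤ _ := by gcongr; exact hsum _
  rw [← hkm, ← Finset.add_sum_erase _ _ (Finset.mem_univ (a : Fˣ ⧸ Γ))] at htot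
  have hrest : ((k : ℝ) - 1) * (m : ℝ) ^ 4 ≤ (m * k + 1) *
      ∑ c ∈ Finset.univ.erase (a : Fˣ ⧸ Γ), ∑ x, cosetRep Γ c x ^ 2 := by
    have h1 := Finset.card_nsmul_le_sum (Finset.univ.erase (a : Fˣ ⧸ Γ))
      (fun c => (m * k + 1) * ∑ x, cosetRep Γ c x ^ 2) _ fun c _ => hgen c
    rw [Finset.card_erase_of_mem (Finset.mem_univ _), Finset.card_univ, hidx, nsmul_eq_mul,
      Nat.cast_sub hk, Nat.cast_one, ← Finset.mul_sum] at h1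
    exact h1
  generalize ∑ x, cosetRep Γ (a : Fˣ ⧸ Γ) x ^ 2 = A at *
  generalize ∑ c ∈ Finset.univ.erase (a : Fˣ ⧸ Γ), ∑ x, cosetRep Γ c x ^ 2 = B at *
  push_cast at htot
  have hm1 : (1 : ℝ) ≤ m := by exact_mod_cast hm
  have hk1 : (1 : ℝ) ≤ k := by exact_mod_cast hk
  have hmk' : (k : ℝ) ^ 3 < m := by exact_mod_cast hmk
  have hr : 0 < (m : ℝ) * k + 1 - m := by nlinarith
  have hq0 : 0 < (m : ℝ) * k + 1 := by nlinarith
  have e1 := mul_le_mul_of_nonneg_left hspec hq0.le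
  have e2 := mul_le_mul_of_nonneg_left hrest hr.le
  have e3 := mul_le_mul_of_nonneg_left htot (mul_pos hq0 hr).le
  have e4 : (m : ℝ) * (m : ℝ) ^ 4 ≤ m * (m * k + 1 - m : ℝ) ^ 3 := by linarith
  have e5 : (m : ℝ) ^ 4 ≤ (m * k + 1 - m : ℝ) ^ 3 := le_of_mul_le_mul_left e4 (by linarith)
  have e6 : (m * k + 1 - m : ℝ) ^ 3 ≤ (m * k : ℝ) ^ 3 :=
    pow_le_pow_left₀ hr.le (by linarith) 3
  have e7 : (m : ℝ) ^ 3 * k ^ 3 < (m : ℝ) ^ 3 * m := by gcongr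
  nlinarith

end Finite

/-- Turnwald's theorem: let `F` be a division ring and `Γ` a proper subgroup
of `Fˣ` of finite index `k`.  If `Fˣ` is infinite or `|Fˣ| > k⁴`, then `Γ - Γ = F`. -/
theorem stmt4 (F : Type*) [DivisionRing F] (Γ : Subgroup Fˣ) (hΓ : Γ ≠ ⊤)
    (k : ℕ) (hk : Γ.index = k) (hk0 : k ≠ 0)
    (h : Infinite Fˣ ∨ k ^ 4 < Nat.card Fˣ) :
    ∀ a : F, ∃ γ₁ γ₂ : Fˣ, γ₁ ∈ Γ ∧ γ₂ ∈ Γ ∧ a = (γ₁ : F) - (γ₂ : F) := by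
  intro a
  by_cases ha : a = 0
  · exact ⟨1, 1, one_mem _, one_mem _, by simp [ha]⟩
  subst hk
  obtain ⟨γ, hγ, δ, hδ, hd⟩ : ∃ γ ∈ Γ, ∃ δ ∈ Γ,
      ((Units.mk0 a ha : Fˣ) : F) = (γ : F) - (δ : F) := by
    rcases finite_or_infinite F with hF | hF
    · have := Fintype.ofFinite F
      exact units_mem_sub_of_finite Γ
        (h.resolve_left fun hinf => hinf.not_finite inferInstance) _
    · have : Γ.FiniteIndex := ⟨hk0⟩
      exact units_mem_sub_of_infinite Γ _
  exact ⟨γ, δ, hγ, hδ, hd⟩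
end

section
/- Let F be a division ring and let Γ be a normal subgroup of Fˣ of finite index n. If there exists an element of F that cannot be written as γ₁ − γ₂ with γ₁, γ₂ ∈ Γ, then F is a finite field and |Fˣ| ≤ n⁴. -/
open Finset in
/-- If an additive commutative monoid is covered by finitely many sets `P c`, then not every `P c`
can have infinitely many pairwise disjoint translates. -/
theorem exists_translates_meet {M Q : Type*} [AddCommMonoid M] [Finite Q] (P : Q → Set M)
    (hP : ∀ x, ∃ c, x ∈ P c) (h : Q → ℕ → M) :
    ∃ c i j x, i < j ∧ x + h c i ∈ P c ∧ x + h c j ∈ P c := by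
  classical
  have := Fintype.ofFinite Q
  by_contra! H
  have H' : ∀ c i j x, x + h c i ∈ P c → x + h c j ∈ P c → i = j := by
    intro c i j x hi hj
    rcases lt_trichotomy i j with hij | hij | hij
    · exact absurd hj (H c i j x hij hi)
    · exact hij
    · exact absurd hi (H c j i x hij hj)
  choose col hcol using hP
  set k := Fintype.card Q + 1
  let σ : (Q → Fin k) → M := fun i => ∑ c, h c (i c)
  let Φ : (Q → Fin k) × Fin k → Q × (Q → Fin k) :=
    fun p => (col (σ p.1), Function.update p.1 (col (σ p.1)) p.2)
  have hΦ : Function.Injective Φ := by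
    rintro ⟨i, l⟩ ⟨i', l'⟩ heq
    simp only [Φ, Prod.mk.injEq] at heq
    obtain ⟨hc, hu⟩ := heq
    have hi := hcol (σ i)
    have hi' := hcol (σ i')
    rw [← hc] at hi' hu
    generalize col (σ i) = c at hi hi' hu
    have hl : l = l' := by simpa using congrFun hu c
    have hoff : ∀ d, d ≠ c → i d = i' d := by
      intro d hd
      simpa [hd] using congrFun hu d
    have hσ : ∀ j : Q → Fin k, σ j = ∑ d ∈ univ.erase c, h d (j d) + h c (j c) := fun j =>
      (sum_erase_add univ (fun d => h d (j d)) (mem_univ c)).symm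
    have hx : ∑ d ∈ univ.erase c, h d (i d) = ∑ d ∈ univ.erase c, h d (i' d) :=
      sum_congr rfl fun d hd => by rw [hoff d (ne_of_mem_erase hd)]
    rw [hσ, hx] at hi
    rw [hσ] at hi'
    have hic : i c = i' c := Fin.ext (H' c _ _ _ hi hi')
    have hii : i = i' := by
      funext d
      by_cases hd : d = c
      · rw [hd, hic]
      · exact hoff d hd
    rw [hii, hl]
  have hcard := Fintype.card_le_of_injective Φ hΦ
  simp only [Fintype.card_prod, Fintype.card_fin, Fintype.card_fun] at hcard
  rw [mul_comm] at hcard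
  have := Nat.le_of_mul_le_mul_right hcard (by positivity)
  omega

/-- Infinite Ramsey theorem for pairs, for finite colourings of an infinite type. -/
theorem exists_seq_monochromatic {α κ : Type*} [Infinite α] [Finite κ] (c : α → α → κ) :
    ∃ (b : κ) (g : ℕ → α), ∀ i j, i < j → g i ≠ g j ∧ c (g i) (g j) = b := by
  have hpure : ∀ f : α → κ, ∃ b, ∀ᶠ y in (Filter.hyperfilter α : Filter α), f y = b := by
    intro f
    obtain ⟨b, hb⟩ := Ultrafilter.eq_pure_of_finite ((Filter.hyperfilter α).map f)
    refine ⟨b, ?_⟩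
    have : ({b} : Set κ) ∈ (Filter.hyperfilter α).map f := by simp [hb]
    exact this
  choose f hf using fun x => hpure (c x)
  obtain ⟨b, hb⟩ := hpure f
  obtain ⟨g, -, hg⟩ := exists_seq_of_forall_finset_exists (fun x => f x = b)
    (fun x y => x ≠ y ∧ c x y = b) (by
      intro s hs
      have hev : ∀ᶠ y in (Filter.hyperfilter α : Filter α), ∀ x ∈ s, x ≠ y ∧ c x y = b := by
        rw [Filter.eventually_all_finset]
        intro x hx
        have hne : ∀ᶠ y in (Filter.hyperfilter α : Filter α), x ≠ y := by
          have := (Set.finite_singleton x).compl_mem_hyperfilter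
          filter_upwards [this] with y hy hxy
          exact hy hxy.symm
        filter_upwards [hne, hf x] with y h1 h2
        exact ⟨h1, h2.trans (hs x hx)⟩
      exact (hb.and hev).exists)
  exact ⟨b, g, hg⟩

/-- In an infinite division ring, every element is a difference of two elements of a given
multiplicative subgroup of finite index. -/
theorem exists_eq_sub_of_finiteIndex {F : Type*} [DivisionRing F] [Infinite F] (Γ : Subgroup Fˣ)
    [Γ.FiniteIndex] (a : F) : ∃ γ₁ γ₂ : Fˣ, γ₁ ∈ Γ ∧ γ₂ ∈ Γ ∧ a = (γ₁ : F) - (γ₂ : F) := by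
  classical
  rcases eq_or_ne a 0 with rfl | ha
  · exact ⟨1, 1, Γ.one_mem, Γ.one_mem, by simp⟩
  lift a to Fˣ using ha.isUnit
  obtain ⟨b, g, hg⟩ := exists_seq_monochromatic fun x y : F =>
    if h : x - y = 0 then ((1 : Fˣ) : Fˣ ⧸ Γ) else (Units.mk0 (x - y) h : Fˣ ⧸ Γ)
  have hdiff : ∀ i j, i < j → ∃ γ ∈ Γ, g i - g j = ((b.out * γ : Fˣ) : F) := by
    intro i j hij
    obtain ⟨hne, hc⟩ := hg i j hij
    rw [dif_neg (sub_ne_zero.2 hne)] at hc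
    refine ⟨b.out⁻¹ * Units.mk0 (g i - g j) (sub_ne_zero.2 hne), ?_, by simp⟩
    rw [← QuotientGroup.eq, hc]
    exact b.out_eq
  obtain ⟨c, i, j, x, hij, hi, hj⟩ := exists_translates_meet
    (Q := Option (Fˣ ⧸ Γ))
    (fun o => o.elim {0} fun c => {x | ∃ γ ∈ Γ, x = ((c.out * γ : Fˣ) : F)})
    (by
      intro x
      rcases eq_or_ne x 0 with rfl | hx
      · exact ⟨none, rfl⟩
      · lift x to Fˣ using hx.isUnit
        refine ⟨some x, (Quotient.out (x : Fˣ ⧸ Γ))⁻¹ * x, ?_, by simp⟩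
        rw [← QuotientGroup.eq]
        exact Quotient.out_eq _)
    (fun o i => o.elim (g i) fun c => ((c.out * a * b.out⁻¹ : Fˣ) : F) * g i)
  cases c with
  | none =>
    have hi : x + g i = 0 := hi
    have hj : x + g j = 0 := hj
    exact absurd (add_left_cancel (hi.trans hj.symm)) (hg i j hij).1
  | some c =>
    obtain ⟨γ₁, h₁, hi⟩ := hi
    obtain ⟨γ₂, h₂, hj⟩ := hj
    obtain ⟨γ, hγ, hd⟩ := hdiff i j hij
    simp only [Option.elim] at hi hj
    have key : ((c.out * a * b.out⁻¹ : Fˣ) : F) * (g i - g j)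
        = ((c.out * γ₁ : Fˣ) : F) - ((c.out * γ₂ : Fˣ) : F) := by
      rw [← hi, ← hj, mul_sub]; abel
    rw [hd, ← Units.val_mul] at key
    have key' : (c.out : F) * ((a * γ : Fˣ) : F) = (c.out : F) * ((γ₁ : F) - γ₂) := by
      rw [mul_sub, ← Units.val_mul, ← Units.val_mul, ← Units.val_mul, ← key]
      congr 1; group
    have key'' := mul_left_cancel₀ c.out.ne_zero key'
    refine ⟨γ₁ * γ⁻¹, γ₂ * γ⁻¹, Γ.mul_mem h₁ (Γ.inv_mem hγ), Γ.mul_mem h₂ (Γ.inv_mem hγ), ?_⟩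
    rw [Units.val_mul, Units.val_mul, ← sub_mul, ← key'', ← Units.val_mul]
    simp

open Finset in
/-- The second moment, over all lines `s ↦ y + u * s` of the plane over a finite division ring,
of the number of incidences with the points of `A × B`. -/
theorem sum_sq_card_incidences {F : Type*} [DivisionRing F] [Fintype F] [DecidableEq F]
    (A B : Finset F) :
    ∑ u : F, ∑ y : F, (∑ s ∈ A, if y + u * s ∈ B then (1 : ℝ) else 0) ^ 2
      = #A * (Fintype.card F * #B) + #A * (#A - 1) * (#B : ℝ) ^ 2 := by
  set f : F → ℝ := fun x => if x ∈ B then 1 else 0 with hf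
  have hsum : ∑ x, f x = #B := by simp [hf]
  have hdiag : ∀ s, ∑ u : F, ∑ y : F, f (y + u * s) * f (y + u * s)
      = Fintype.card F * #B := by
    intro s
    have : ∀ u : F, ∑ y : F, f (y + u * s) * f (y + u * s) = #B := by
      intro u
      rw [← hsum, ← Equiv.sum_comp (Equiv.addRight (u * s)) f]
      refine sum_congr rfl fun y _ => ?_
      simp [hf]
    simp [this]
  have hoff : ∀ s t, s ≠ t → ∑ u : F, ∑ y : F, f (y + u * s) * f (y + u * t)
      = (#B : ℝ) ^ 2 := by
    intro s t hst
    have hbij : Function.Bijective fun p : F × F => (p.2 + p.1 * s, p.2 + p.1 * t) := by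
      rw [← Finite.injective_iff_bijective]
      rintro ⟨u, y⟩ ⟨u', y'⟩ h
      simp only [Prod.mk.injEq] at h
      have hu : u * (s - t) = u' * (s - t) := by
        rw [mul_sub, mul_sub, ← add_sub_add_left_eq_sub _ _ y, h.1, h.2,
          add_sub_add_left_eq_sub]
      have hu := mul_right_cancel₀ (sub_ne_zero.2 hst) hu
      subst hu
      simpa using h.1
    rw [← Fintype.sum_prod_type' (fun u y => f (y + u * s) * f (y + u * t)),
      hbij.sum_comp (fun p : F × F => f p.1 * f p.2), sq, ← hsum, Fintype.sum_prod_type,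
      sum_mul_sum]
  calc ∑ u : F, ∑ y : F, (∑ s ∈ A, f (y + u * s)) ^ 2
      = ∑ s ∈ A, ∑ t ∈ A, ∑ u : F, ∑ y : F, f (y + u * s) * f (y + u * t) := by
        simp_rw [sq, sum_mul_sum]
        rw [← Fintype.sum_prod_type'
          (fun u y => ∑ s ∈ A, ∑ t ∈ A, f (y + u * s) * f (y + u * t)), sum_comm]
        refine sum_congr rfl fun s _ => ?_
        rw [sum_comm]
        exact sum_congr rfl fun t _ => Fintype.sum_prod_type _
    _ = ∑ s ∈ A, ∑ t ∈ A, ((#B : ℝ) ^ 2 +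
          if s = t then (Fintype.card F * #B : ℝ) - (#B : ℝ) ^ 2 else 0) := by
        refine sum_congr rfl fun s _ => sum_congr rfl fun t _ => ?_
        split_ifs with h
        · subst h
          rw [hdiag]; ring
        · rw [hoff s t h, add_zero]
    _ = _ := by
        simp only [sum_add_distrib, sum_const, sum_ite_eq, nsmul_eq_mul, ← sum_filter,
          filter_mem_eq_inter, inter_self]
        ring

open Finset in
/-- If no line `s ↦ y + u * s` with `u, y ∈ B` meets `A × B`, where `#A = #B`, then `B` is small. -/
theorem card_pow_four_le_of_no_incidences {F : Type*} [DivisionRing F] [Fintype F] [DecidableEq F]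
    (A B : Finset F) (hAB : #A = #B) (hB : B.Nonempty) (h0 : 0 ∉ B)
    (h : ∀ u ∈ B, ∀ y ∈ B, ∀ s ∈ A, y + u * s ∉ B) :
    (#B : ℝ) ^ 4 ≤ (Fintype.card F - #B : ℝ) ^ 3 := by
  have htot := sum_sq_card_incidences A B
  set m : ℝ := (#B : ℝ) with hm
  set q : ℝ := (Fintype.card F : ℝ) with hq
  rw [hAB, ← hm] at htot
  set I : F → F → ℝ := fun u y => ∑ s ∈ A, if y + u * s ∈ B then (1 : ℝ) else 0 with hI
  have hm0 : 0 < m := by rw [hm]; exact_mod_cast hB.card_pos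
  have hcompl : (#Bᶜ : ℝ) = q - m := by
    rw [card_compl, Nat.cast_sub (card_le_univ B)]
  have hd0 : 0 < q - m := by
    rw [← hcompl]
    exact_mod_cast card_pos.2 ⟨0, by simpa using h0⟩
  have hq0 : 0 < q := by linarith
  have hsum : ∀ u, ∑ y, I u y = m ^ 2 := by
    intro u
    have : ∀ s, (∑ y, if y + u * s ∈ B then (1 : ℝ) else 0) = m := by
      intro s
      have := Equiv.sum_comp (Equiv.addRight (u * s)) fun x => if x ∈ B then (1 : ℝ) else 0
      simp only [Equiv.coe_addRight] at this
      exact this.trans (by simp [hm])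
    rw [hI, sum_comm, sum_congr rfl fun s _ => this s, sum_const, nsmul_eq_mul, hAB]
    ring
  have hgen : ∀ u, m ^ 4 / q ≤ ∑ y, I u y ^ 2 := by
    intro u
    rw [div_le_iff₀' hq0]
    have := sq_sum_le_card_mul_sum_sq (s := univ) (f := I u)
    rw [hsum, card_univ] at this
    linarith [this]
  have hmem : ∀ u ∈ B, m ^ 4 / (q - m) ≤ ∑ y, I u y ^ 2 := by
    intro u hu
    have hz : ∀ y ∈ B, I u y = 0 := fun y hy =>
      sum_eq_zero fun s hs => if_neg (h u hu y hy s hs)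
    have h1 : ∑ y ∈ Bᶜ, I u y = m ^ 2 := by
      rw [← hsum u, ← sum_add_sum_compl B, sum_eq_zero hz, zero_add]
    have h2 : ∑ y ∈ Bᶜ, I u y ^ 2 ≤ ∑ y, I u y ^ 2 :=
      sum_le_sum_of_subset_of_nonneg (subset_univ _) fun _ _ _ => sq_nonneg _
    have := sq_sum_le_card_mul_sum_sq (s := Bᶜ) (f := I u)
    rw [h1, hcompl] at this
    rw [div_le_iff₀' hd0]
    calc m ^ 4 = (m ^ 2) ^ 2 := by ring
      _ ≤ _ := this
      _ ≤ _ := by gcongr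
  have hzero : ∑ y, I 0 y ^ 2 = m ^ 3 := by
    have : ∀ y, I 0 y ^ 2 = m ^ 2 * if y ∈ B then 1 else 0 := by
      intro y
      simp only [hI, zero_mul, add_zero, sum_const, nsmul_eq_mul, hAB]
      split_ifs <;> simp [hm]
    rw [sum_congr rfl fun y _ => this y, ← mul_sum]
    simp only [sum_boole, filter_univ_mem, ← hm]
    ring
  have hlow : ∑ u : F, (m ^ 4 / q + (if u = 0 then m ^ 3 - m ^ 4 / q else 0)
      + if u ∈ B then m ^ 4 / (q - m) - m ^ 4 / q else 0) ≤ ∑ u, ∑ y, I u y ^ 2 := by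
    refine sum_le_sum fun u _ => ?_
    by_cases hu0 : u = 0
    · subst hu0
      simp [h0, hzero]
    · by_cases huB : u ∈ B
      · simpa [hu0, huB] using hmem u huB
      · simpa [hu0, huB] using hgen u
  rw [htot] at hlow
  simp only [sum_add_distrib, sum_const, sum_ite_eq', mem_univ, if_true, nsmul_eq_mul, card_univ,
    sum_ite_mem, univ_inter, ← hm, ← hq] at hlow
  clear_value q
  generalize hd : q - m = d at *
  obtain rfl : q = d + m := by linarith
  have hdiff : m * ((d + m) * m) + m * (m - 1) * m ^ 2
      - ((d + m) * (m ^ 4 / (d + m)) + (m ^ 3 - m ^ 4 / (d + m))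
        + m * (m ^ 4 / d - m ^ 4 / (d + m))) = m ^ 2 / (d * (d + m)) * (d ^ 3 - m ^ 4) := by
    field_simp
    ring
  have hnn : 0 ≤ m ^ 2 / (d * (d + m)) * (d ^ 3 - m ^ 4) := by
    rw [← hdiff]; linarith
  have := nonneg_of_mul_nonneg_right hnn (by positivity)
  linarith

/-- In a finite division ring, a multiplicative subgroup `Γ` of index `n` with `Γ - Γ ≠ F` has at
most `n ^ 3` elements. -/
theorem card_le_index_pow_three {F : Type*} [DivisionRing F] [Finite F] (Γ : Subgroup Fˣ)
    (h : ∃ a : F, ¬ ∃ γ₁ γ₂ : Fˣ, γ₁ ∈ Γ ∧ γ₂ ∈ Γ ∧ a = (γ₁ : F) - (γ₂ : F)) :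
    Nat.card Γ ≤ Γ.index ^ 3 := by
  classical
  have := Fintype.ofFinite F
  obtain ⟨a, ha⟩ := h
  have ha0 : a ≠ 0 := by
    rintro rfl
    exact ha ⟨1, 1, Γ.one_mem, Γ.one_mem, by simp⟩
  let B : Finset F := Finset.univ.image fun γ : Γ => ((γ : Fˣ) : F)
  have hBmem : ∀ x, x ∈ B ↔ ∃ γ ∈ Γ, (γ : F) = x := by simp [B]
  have hB : B.card = Nat.card Γ := by
    have hinj : Function.Injective fun γ : Γ => ((γ : Fˣ) : F) :=
      Units.val_injective.comp Subtype.val_injective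
    rw [Finset.card_image_of_injective _ hinj, Finset.card_univ, Nat.card_eq_fintype_card]
  have hpos : 0 < Nat.card Γ := Nat.card_pos
  have key := card_pow_four_le_of_no_incidences (B.image (· * a)) B
    (Finset.card_image_of_injective _ (mul_left_injective₀ ha0))
    (Finset.card_pos.1 (hB ▸ hpos))
    (by
      rw [hBmem]
      rintro ⟨γ, -, hγ⟩
      exact γ.ne_zero hγ)
    (by
      intro u hu y hy s hs hz
      obtain ⟨t, ht, rfl⟩ := Finset.mem_image.1 hs
      rw [hBmem] at hu hy ht hz
      obtain ⟨u, hu, rfl⟩ := hu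
      obtain ⟨y, hy, rfl⟩ := hy
      obtain ⟨t, ht, rfl⟩ := ht
      obtain ⟨z, hz, hzeq⟩ := hz
      have hut := Γ.inv_mem (Γ.mul_mem hu ht)
      refine ha ⟨(u * t)⁻¹ * z, (u * t)⁻¹ * y, Γ.mul_mem hut hz, Γ.mul_mem hut hy, ?_⟩
      rw [Units.val_mul, Units.val_mul, ← mul_sub, hzeq, add_sub_cancel_left, ← mul_assoc,
        ← Units.val_mul, ← mul_assoc, ← Units.val_mul]
      simp)
  have hq : (Fintype.card F : ℝ) = Nat.card Γ * Γ.index + 1 := by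
    rw [← Nat.card_eq_fintype_card, ← Nat.cast_mul, Γ.card_mul_index]
    exact_mod_cast Nat.card_eq_card_units_add_one F
  rw [hB, hq] at key
  have hm1 : (1 : ℝ) ≤ Nat.card Γ := by exact_mod_cast hpos
  have hi1 : (1 : ℝ) ≤ Γ.index := by
    exact_mod_cast Nat.one_le_iff_ne_zero.2 Subgroup.index_ne_zero_of_finite
  rw [← Nat.cast_le (α := ℝ), Nat.cast_pow]
  generalize (Nat.card Γ : ℝ) = m at *
  generalize (Γ.index : ℝ) = n at *
  have hle : (m * n + 1 - m) ^ 3 ≤ (m * n) ^ 3 := by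
    have : 0 ≤ m * n + 1 - m := by nlinarith
    gcongr
    linarith
  have : m ^ 3 * m ≤ m ^ 3 * n ^ 3 := by
    calc m ^ 3 * m = m ^ 4 := by ring
      _ ≤ (m * n) ^ 3 := key.trans hle
      _ = _ := by ring
  exact le_of_mul_le_mul_left this (by positivity)


/-- let `F` be a division ring and `Γ` a normal subgroup of `Fˣ` of finite
index `n`.  If some element of `F` is not a difference of two elements of `Γ`, then `F`
is a finite field (finite and commutative) with `|Fˣ| ≤ n⁴`. -/
theorem stmt5 (F : Type*) [DivisionRing F] (Γ : Subgroup Fˣ) (hnorm : Γ.Normal)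
    (n : ℕ) (hn : Γ.index = n) (hn0 : n ≠ 0)
    (h : ∃ a : F, ¬ ∃ γ₁ γ₂ : Fˣ, γ₁ ∈ Γ ∧ γ₂ ∈ Γ ∧ a = (γ₁ : F) - (γ₂ : F)) :
    Finite F ∧ (∀ a b : F, a * b = b * a) ∧ Nat.card Fˣ ≤ n ^ 4 := by
  subst hn
  have : Γ.FiniteIndex := ⟨hn0⟩
  have hfin : Finite F := by
    by_contra hinf
    have : Infinite F := not_finite_iff_infinite.1 hinf
    obtain ⟨a, ha⟩ := h
    exact ha (exists_eq_sub_of_finiteIndex Γ a)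
  refine ⟨hfin, fun a b => (littleWedderburn F).mul_comm a b, ?_⟩
  rw [← Γ.card_mul_index, pow_succ]
  exact Nat.mul_le_mul_right _ (card_le_index_pow_three Γ h)
end

section
/- There exist a constant c > 0 and a threshold N₀ such that for every finite abelian group G with |G| = n ≥ N₀, the number of symmetric subsets S ⊆ G³ that fail condition (⋆) is at most e^{−cn}·2^{h(G)}. -/
/-- A subset `S ⊆ G³` is symmetric if it is closed under all permutations of the three
coordinates (swap and cycle generate `S₃`) and under the diagonal left-multiplication
action of `G`. -/
def IsSymmetric {G : Type*} [CommGroup G] (S : Set (G × G × G)) : Prop :=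
  (∀ x y z : G, (x, y, z) ∈ S → (y, x, z) ∈ S) ∧
  (∀ x y z : G, (x, y, z) ∈ S → (y, z, x) ∈ S) ∧
  (∀ g x y z : G, (x, y, z) ∈ S → (g * x, g * y, g * z) ∈ S)

/-- Condition (⋆): for all `x y z w` there is `t` with `(tx,ty,1) ∈ S` and `(tz,tw,1) ∈ S`. -/
def CondStar {G : Type*} [CommGroup G] (S : Set (G × G × G)) : Prop :=
  ∀ x y z w : G, ∃ t : G, (t * x, t * y, 1) ∈ S ∧ (t * z, t * w, 1) ∈ S

open Classical in
theorem exists_large_independent {ι : Type*} [Fintype ι] (r : ι → ι → Prop)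
    (hrefl : ∀ i, r i i) (hsymm : ∀ i j, r i j → r j i) (D : ℕ)
    (hD : ∀ i, (Finset.univ.filter (r i)).card ≤ D) :
    ∃ I : Finset ι, (∀ i ∈ I, ∀ j ∈ I, i ≠ j → ¬ r i j) ∧ Fintype.card ι ≤ I.card * D := by
  obtain ⟨I, hI, hmax⟩ := Finset.exists_max_image
    (Finset.univ.filter fun I : Finset ι => ∀ i ∈ I, ∀ j ∈ I, i ≠ j → ¬ r i j) Finset.card
    ⟨∅, by simp⟩
  simp only [Finset.mem_filter, Finset.mem_univ, true_and] at hI hmax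
  refine ⟨I, hI, ?_⟩
  have hcover : (Finset.univ : Finset ι) ⊆ I.biUnion fun i => Finset.univ.filter (r i) := by
    intro j _
    simp only [Finset.mem_biUnion, Finset.mem_filter, Finset.mem_univ, true_and]
    by_contra! hj
    have hjI : j ∉ I := fun h => hj j h (hrefl j)
    have := hmax (insert j I) (by
      intro a ha b hb hab
      rcases Finset.mem_insert.1 ha with rfl | ha <;> rcases Finset.mem_insert.1 hb with hba | hb
      · exact absurd hba.symm hab
      · exact fun h => hj b hb (hsymm _ _ h)
      · exact hba ▸ hj a ha
      · exact hI a ha b hb hab)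
    rw [Finset.card_insert_of_notMem hjI] at this
    omega
  calc Fintype.card ι ≤ _ := Finset.card_le_card hcover
    _ ≤ I.card * D := Finset.card_biUnion_le_card_mul _ _ _ fun i _ => hD i

open Classical in
theorem card_avoiding_pairs_le {Q ι : Type*} [Fintype Q] (a b : ι → Q) (I : Finset ι)
    (hI : ∀ i ∈ I, ∀ j ∈ I, i ≠ j →
      ¬ (a i = a j ∨ a i = b j ∨ b i = a j ∨ b i = b j)) :
    ((Finset.univ.filter fun T : Finset Q => ∀ i ∈ I, ¬ (a i ∈ T ∧ b i ∈ T)).card : ℝ) ≤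
      (3 / 4) ^ I.card * 2 ^ Fintype.card Q := by
  induction I using Finset.induction_on with
  | empty => simp
  | insert i I hi ih =>
    have ih := ih fun j hj k hk =>
      hI j (Finset.mem_insert_of_mem hj) k (Finset.mem_insert_of_mem hk)
    set F := Finset.univ.filter fun T : Finset Q => ∀ j ∈ I, ¬ (a j ∈ T ∧ b j ∈ T) with hF
    have hsplit := Finset.card_filter_add_card_filter_not (s := F) fun T => a i ∈ T ∧ b i ∈ T
    have hnew : (Finset.univ.filter fun T : Finset Q =>
        ∀ j ∈ insert i I, ¬ (a j ∈ T ∧ b j ∈ T)) =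
        F.filter fun T => ¬ (a i ∈ T ∧ b i ∈ T) := by
      ext T
      simp only [hF, Finset.mem_filter, Finset.mem_univ, true_and, Finset.forall_mem_insert]
      tauto
    have hfour : F.card ≤ 4 * (F.filter fun T => a i ∈ T ∧ b i ∈ T).card := by
      refine Finset.card_le_mul_card_image_of_maps_to (f := fun T => T ∪ {a i, b i}) ?_ 4 ?_
      · intro T hT
        simp only [hF, Finset.mem_filter, Finset.mem_univ, true_and] at hT ⊢
        refine ⟨fun j hj => ?_, by simp, by simp⟩
        have hd := hI j (Finset.mem_insert_of_mem hj) i (Finset.mem_insert_self _ _)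
          (fun h => hi (h ▸ hj))
        have ha : a j ∉ ({a i, b i} : Finset Q) := by
          simp only [Finset.mem_insert, Finset.mem_singleton]
          tauto
        have hb : b j ∉ ({a i, b i} : Finset Q) := by
          simp only [Finset.mem_insert, Finset.mem_singleton]
          tauto
        rw [Finset.mem_union, Finset.mem_union]
        have := hT j hj
        tauto
      · intro U _
        have hpow : (({a i, b i} : Finset Q).powerset).card ≤ 4 := by
          rw [Finset.card_powerset]
          exact (Nat.pow_le_pow_right (by norm_num) Finset.card_le_two).trans (by norm_num)
        refine (Finset.card_le_card_of_injOn (fun T => T ∩ {a i, b i}) ?_ ?_).trans hpow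
        · intro T _
          simp
        · intro T hT T' hT' h
          have h1 := (Finset.mem_filter.1 hT).2
          have h2 := (Finset.mem_filter.1 hT').2
          ext x
          have e1 := Finset.ext_iff.1 (h1.trans h2.symm) x
          have e2 := Finset.ext_iff.1 h x
          simp only [Finset.mem_union, Finset.mem_inter] at e1 e2
          tauto
    rw [hnew, Finset.card_insert_of_notMem hi, pow_succ]
    have h1 : ((F.filter fun T => a i ∈ T ∧ b i ∈ T).card : ℝ) +
        (F.filter fun T => ¬ (a i ∈ T ∧ b i ∈ T)).card = F.card := by exact_mod_cast hsplit
    have h2 : (F.card : ℝ) ≤ 4 * (F.filter fun T => a i ∈ T ∧ b i ∈ T).card := by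
      exact_mod_cast hfour
    linarith

theorem hexRel_refl {G : Type*} [CommGroup G] (v : G × G × G) : hexRel v v :=
  ⟨1, Or.inl (by simp)⟩

theorem IsSymmetric.mem_of_hexRel {G : Type*} [CommGroup G] {S : Set (G × G × G)}
    (hS : IsSymmetric S) {v w : G × G × G} (hv : v ∈ S) (h : hexRel v w) : w ∈ S := by
  obtain ⟨hswap, hcycle, hmul⟩ := hS
  obtain ⟨x, y, z⟩ := v
  have hyzx := hcycle _ _ _ hv
  have hzxy := hcycle _ _ _ hyzx
  obtain ⟨g, rfl | rfl | rfl | rfl | rfl | rfl⟩ := h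
  · exact hmul _ _ _ _ hv
  · exact hmul _ _ _ _ (hswap _ _ _ hzxy)
  · exact hmul _ _ _ _ (hswap _ _ _ hv)
  · exact hmul _ _ _ _ hyzx
  · exact hmul _ _ _ _ hzxy
  · exact hmul _ _ _ _ (hswap _ _ _ hyzx)

/-- The hexagon through a triple. -/
def hexagonOf {G : Type*} [CommGroup G] (v : G × G × G) :
    {H : Set (G × G × G) // IsHexagon H} :=
  ⟨{w | hexRel v w}, v, rfl⟩

theorem hexRel_of_hexagonOf_eq {G : Type*} [CommGroup G] {v w : G × G × G}
    (h : hexagonOf v = hexagonOf w) : hexRel v w := by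
  have hw : w ∈ (hexagonOf w).1 := hexRel_refl w
  rwa [← h] at hw

theorem IsSymmetric.hexagonOf_subset_iff {G : Type*} [CommGroup G] {S : Set (G × G × G)}
    (hS : IsSymmetric S) (v : G × G × G) : (hexagonOf v).1 ⊆ S ↔ v ∈ S :=
  ⟨fun h => h (hexRel_refl v), fun hv _ hw => hS.mem_of_hexRel hv hw⟩

open Classical in
theorem card_hexagonOf_eq_le {G : Type*} [CommGroup G] [Fintype G] (v : G × G × G) (p q : G) :
    (Finset.univ.filter fun u : G => hexagonOf v = hexagonOf (p, q, u)).card ≤ 6 := by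
  refine (Finset.card_le_card (t := {p * v.1⁻¹ * v.2.2, p * v.1⁻¹ * v.2.1, p * v.2.1⁻¹ * v.2.2,
    p * v.2.1⁻¹ * v.1, p * v.2.2⁻¹ * v.2.1, p * v.2.2⁻¹ * v.1}) ?_).trans Finset.card_le_six
  intro u hu
  obtain ⟨g, h⟩ := hexRel_of_hexagonOf_eq (Finset.mem_filter.1 hu).2
  simp only [Prod.mk.injEq] at h
  simp only [Finset.mem_insert, Finset.mem_singleton]
  rcases h with ⟨rfl, -, rfl⟩ | ⟨rfl, -, rfl⟩ | ⟨rfl, -, rfl⟩ | ⟨rfl, -, rfl⟩ | ⟨rfl, -, rfl⟩ |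
    ⟨rfl, -, rfl⟩ <;> simp

open Classical in
theorem card_avoiding_hexagons_le {G : Type*} [CommGroup G] [Fintype G] (x y z w : G) :
    ((Finset.univ.filter fun T : Finset {H : Set (G × G × G) // IsHexagon H} =>
      ∀ u : G, ¬ (hexagonOf (x, y, u) ∈ T ∧ hexagonOf (z, w, u) ∈ T)).card : ℝ) ≤
      Real.exp (-(Fintype.card G / 96)) * 2 ^ numHexagons G := by
  set a : G → {H : Set (G × G × G) // IsHexagon H} := fun u => hexagonOf (x, y, u) with ha
  set b : G → {H : Set (G × G × G) // IsHexagon H} := fun u => hexagonOf (z, w, u) with hb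
  obtain ⟨I, hI, hcard⟩ := exists_large_independent
    (fun u u' => a u = a u' ∨ a u = b u' ∨ b u = a u' ∨ b u = b u')
    (fun u => Or.inl rfl) (fun u u' h => by simp only [eq_comm] at h ⊢; tauto) 24 (by
      intro u
      refine (Finset.card_le_card
        (t := ((Finset.univ.filter fun u' => a u = a u') ∪
            (Finset.univ.filter fun u' => a u = b u')) ∪
          ((Finset.univ.filter fun u' => b u = a u') ∪
            (Finset.univ.filter fun u' => b u = b u'))) fun u' h => ?_).trans ?_
      · simp only [Finset.mem_filter, Finset.mem_univ, true_and, Finset.mem_union] at h ⊢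
        tauto
      refine (Finset.card_union_le _ _).trans ?_
      have h1 := Finset.card_union_le (Finset.univ.filter fun u' => a u = a u')
        (Finset.univ.filter fun u' => a u = b u')
      have h2 := Finset.card_union_le (Finset.univ.filter fun u' => b u = a u')
        (Finset.univ.filter fun u' => b u = b u')
      have h3 := card_hexagonOf_eq_le (x, y, u) x y
      have h4 := card_hexagonOf_eq_le (x, y, u) z w
      have h5 := card_hexagonOf_eq_le (z, w, u) x y
      have h6 := card_hexagonOf_eq_le (z, w, u) z w
      simp only [ha, hb] at *
      omega)
  have hle := card_avoiding_pairs_le a b I hI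
  rw [← Nat.card_eq_fintype_card] at hle
  refine le_trans (le_trans ?_ hle) ?_
  · refine Nat.cast_le.2 (Finset.card_le_card fun T hT => ?_)
    simp only [Finset.mem_filter, Finset.mem_univ, true_and] at hT ⊢
    exact fun u _ => hT u
  · refine mul_le_mul_of_nonneg_right ?_ (by positivity)
    have hcard' : (Fintype.card G : ℝ) ≤ I.card * 24 := by exact_mod_cast hcard
    have hbase : (3 / 4 : ℝ) ≤ Real.exp (-(1 / 4)) := by
      linarith [Real.add_one_le_exp (-(1 / 4) : ℝ)]
    calc (3 / 4 : ℝ) ^ I.card ≤ Real.exp (-(1 / 4)) ^ I.card :=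
          pow_le_pow_left₀ (by norm_num) hbase _
      _ = Real.exp (I.card * -(1 / 4)) := (Real.exp_nat_mul _ _).symm
      _ ≤ _ := Real.exp_le_exp.2 (by linarith)

theorem exists_avoided_pair {G : Type*} [CommGroup G] {S : Set (G × G × G)}
    (hS : IsSymmetric S) (hstar : ¬ CondStar S) :
    ∃ x y z w : G, ∀ u : G, ¬ ((x, y, u) ∈ S ∧ (z, w, u) ∈ S) := by
  simp only [CondStar, not_forall] at hstar
  obtain ⟨x, y, z, w, h⟩ := hstar
  refine ⟨x, y, z, w, fun u hu => h ⟨u⁻¹, ?_, ?_⟩⟩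
  · simpa using hS.2.2 u⁻¹ _ _ _ hu.1
  · simpa using hS.2.2 u⁻¹ _ _ _ hu.2

open Classical in
theorem card_not_condStar_le {G : Type*} [CommGroup G] [Fintype G] :
    (Nat.card {S : Set (G × G × G) // IsSymmetric S ∧ ¬ CondStar S} : ℝ) ≤
      (Fintype.card G : ℝ) ^ 4 *
        (Real.exp (-(Fintype.card G / 96)) * 2 ^ numHexagons G) := by
  let F : G × G × G × G → Finset (Finset {H : Set (G × G × G) // IsHexagon H}) := fun p =>
    Finset.univ.filter fun T =>
      ∀ u : G, ¬ (hexagonOf (p.1, p.2.1, u) ∈ T ∧ hexagonOf (p.2.2.1, p.2.2.2, u) ∈ T)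
  let f : {S : Set (G × G × G) // IsSymmetric S ∧ ¬ CondStar S} →
      Finset {H : Set (G × G × G) // IsHexagon H} := fun S =>
    Finset.univ.filter fun H => H.1 ⊆ S.1
  have hf : ∀ S v, hexagonOf v ∈ f S ↔ v ∈ S.1 := fun S v => by
    simp [f, S.2.1.hexagonOf_subset_iff]
  have hle : Nat.card {S : Set (G × G × G) // IsSymmetric S ∧ ¬ CondStar S} ≤
      (Finset.univ.biUnion F).card := by
    rw [Nat.card_eq_fintype_card, ← Finset.card_univ]
    refine Finset.card_le_card_of_injOn f ?_ ?_
    · intro S _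
      obtain ⟨x, y, z, w, h⟩ := exists_avoided_pair S.2.1 S.2.2
      refine Finset.mem_coe.2 (Finset.mem_biUnion.2 ⟨(x, y, z, w), Finset.mem_univ _, ?_⟩)
      simpa only [F, Finset.mem_filter, Finset.mem_univ, true_and, hf] using h
    · intro S _ S' _ h
      ext v
      rw [← hf, h, hf]
  calc (Nat.card {S : Set (G × G × G) // IsSymmetric S ∧ ¬ CondStar S} : ℝ)
      ≤ ∑ p, ((F p).card : ℝ) := by exact_mod_cast hle.trans Finset.card_biUnion_le
    _ ≤ ∑ _p : G × G × G × G, Real.exp (-(Fintype.card G / 96)) * 2 ^ numHexagons G :=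
        Finset.sum_le_sum fun p _ => card_avoiding_hexagons_le _ _ _ _
    _ = _ := by
        simp only [Finset.sum_const, Finset.card_univ, Fintype.card_prod, nsmul_eq_mul,
          Nat.cast_mul]
        ring

/-- there are `c > 0` and `N₀` such that for every finite abelian group `G`
of order `n ≥ N₀`, the number of symmetric subsets of `G³` failing condition (⋆) is at
most `e^{-cn} · 2^{h(G)}`. -/
theorem stmt6 :
    ∃ c : ℝ, 0 < c ∧ ∃ N₀ : ℕ, ∀ (G : Type) [CommGroup G] [Fintype G],
      N₀ ≤ Fintype.card G →
      (Nat.card {S : Set (G × G × G) // IsSymmetric S ∧ ¬ CondStar S} : ℝ) ≤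
        Real.exp (-(c * Fintype.card G)) * 2 ^ numHexagons G := by
  have hlim := (isLittleO_pow_exp_pos_mul_atTop 4 (b := 1 / 192) (by norm_num)).bound
    (c := 1) one_pos
  obtain ⟨N₀, hN₀⟩ := Filter.eventually_atTop.1 (tendsto_natCast_atTop_atTop.eventually hlim)
  refine ⟨1 / 192, by norm_num, N₀, fun G _ _ hG => card_not_condStar_le.trans ?_⟩
  rw [← mul_assoc]
  refine mul_le_mul_of_nonneg_right ?_ (by positivity)
  have h := hN₀ _ hG
  rw [one_mul, Real.norm_of_nonneg (by positivity), Real.norm_of_nonneg (by positivity)] at h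
  refine (mul_le_mul_of_nonneg_right h (by positivity)).trans ?_
  rw [← Real.exp_add]
  exact Real.exp_le_exp.2 (by linarith)
end

section
/- Let G be a finite abelian group of order n and let f be a non-identity automorphism of G, acting on G³ componentwise; this action permutes the hexagons of G. Then the number of hexagons H of G with f(H) = H (setwise) is at most h(G^f) + 5n, where G^f = {g ∈ G : f(g) = g} is the subgroup of fixed points of f and h(G^f) is its number of hexagons. -/
/-- The subgroup of fixed points of an automorphism of `G`. -/
def fixedSubgroup {G : Type*} [CommGroup G] (f : G ≃* G) : Subgroup G where
  carrier := {g | f g = g}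
  one_mem' := map_one f
  mul_mem' := by
    intro a b ha hb
    simp only [Set.mem_setOf_eq] at *
    rw [map_mul, ha, hb]
  inv_mem' := by
    intro a ha
    simp only [Set.mem_setOf_eq] at *
    rw [map_inv, ha]

theorem hexRel_symm {G : Type*} [CommGroup G] {v w : G × G × G} (h : hexRel v w) :
    hexRel w v := by
  obtain ⟨g, h⟩ := h
  refine ⟨g⁻¹, ?_⟩
  rcases h with rfl | rfl | rfl | rfl | rfl | rfl <;> simp

theorem hexRel_trans {G : Type*} [CommGroup G] {u v w : G × G × G} (h : hexRel u v)
    (h' : hexRel v w) : hexRel u w := by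
  obtain ⟨g, h⟩ := h
  obtain ⟨k, h'⟩ := h'
  refine ⟨k * g, ?_⟩
  rcases h with rfl | rfl | rfl | rfl | rfl | rfl <;>
    rcases h' with rfl | rfl | rfl | rfl | rfl | rfl <;> simp [mul_assoc]

theorem setOf_hexRel_eq {G : Type*} [CommGroup G] {v w : G × G × G} (h : hexRel v w) :
    {u | hexRel v u} = {u | hexRel w u} :=
  Set.ext fun _ => ⟨hexRel_trans (hexRel_symm h), hexRel_trans h⟩

/-- Inclusion of a subgroup preserves the relation of lying in the same hexagon. -/
theorem hexRel_coe {G : Type*} [CommGroup G] {K : Subgroup G} {v w : K × K × K}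
    (h : hexRel v w) :
    hexRel ((v.1 : G), (v.2.1 : G), (v.2.2 : G)) ((w.1 : G), (w.2.1 : G), (w.2.2 : G)) := by
  obtain ⟨g, h⟩ := h
  refine ⟨g, ?_⟩
  rcases h with rfl | rfl | rfl | rfl | rfl | rfl <;> simp

/-- If `f` maps a triple into its own hexagon, then this hexagon contains a triple of
fixed points of `f`, a triple `(1, x, f x)` or a triple `(1, x, x * f x)`. -/
theorem exists_hexRel_of_hexRel_map {G : Type*} [CommGroup G] (f : G ≃* G) (v : G × G × G)
    (h : hexRel v (f v.1, f v.2.1, f v.2.2)) :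
    (∃ u : fixedSubgroup f × fixedSubgroup f × fixedSubgroup f,
        hexRel v ((u.1 : G), (u.2.1 : G), (u.2.2 : G))) ∨
      (∃ x, hexRel v (1, x, f x)) ∨ ∃ x, hexRel v (1, x, x * f x) := by
  obtain ⟨a, b, c⟩ := v
  obtain ⟨g, h⟩ := h
  simp only [Prod.mk.injEq] at h
  rcases h with ⟨ha, hb, hc⟩ | ⟨ha, hb, hc⟩ | ⟨ha, hb, hc⟩ | ⟨ha, hb, hc⟩ | ⟨ha, hb, hc⟩ |
    ⟨ha, hb, hc⟩
  · have hb' : f (a⁻¹ * b) = a⁻¹ * b := by simp [ha, hb]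
    have hc' : f (a⁻¹ * c) = a⁻¹ * c := by simp [ha, hc]
    exact Or.inl ⟨(1, ⟨a⁻¹ * b, hb'⟩, ⟨a⁻¹ * c, hc'⟩), a⁻¹, by simp⟩
  · exact Or.inr (Or.inl ⟨a⁻¹ * b, a⁻¹, by simp [ha, hb]⟩)
  · exact Or.inr (Or.inl ⟨c⁻¹ * a, c⁻¹, by simp [ha, hc]⟩)
  · exact Or.inr (Or.inr ⟨a⁻¹ * b, a⁻¹, by simp [ha, hb, mul_assoc]⟩)
  · exact Or.inr (Or.inr ⟨a⁻¹ * c, a⁻¹, by simp [ha, hc, mul_assoc]⟩)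
  · exact Or.inr (Or.inl ⟨b⁻¹ * a, b⁻¹, by simp [ha, hb]⟩)

/-- for a finite abelian group `G` of order `n` and a non-identity
automorphism `f` of `G` acting on `G³` componentwise, the number of hexagons fixed
setwise by `f` is at most `h(G^f) + 5n`. -/
theorem stmt8 (G : Type*) [CommGroup G] [Fintype G] (f : G ≃* G)
    (hf : f ≠ MulEquiv.refl G) :
    Nat.card {H : Set (G × G × G) // IsHexagon H ∧
        (fun v : G × G × G => (f v.1, f v.2.1, f v.2.2)) '' H = H} ≤
      numHexagons ↥(fixedSubgroup f) + 5 * Fintype.card G := by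
  let K := fixedSubgroup f
  let Φ : {H : Set (K × K × K) // IsHexagon H} ⊕ (G ⊕ G) → Set (G × G × G) :=
    Sum.elim (fun H => {w | hexRel ((H.2.choose.1 : G), (H.2.choose.2.1 : G),
        (H.2.choose.2.2 : G)) w})
      (Sum.elim (fun x => {w | hexRel (1, x, f x) w}) (fun x => {w | hexRel (1, x, x * f x) w}))
  have hΦ : {H : Set (G × G × G) | IsHexagon H ∧
      (fun v : G × G × G => (f v.1, f v.2.1, f v.2.2)) '' H = H} ⊆ Set.range Φ := by
    rintro H ⟨⟨v, rfl⟩, hH⟩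
    have hv : hexRel v (f v.1, f v.2.1, f v.2.2) :=
      hH.subset ⟨v, hexRel_refl v, rfl⟩
    rcases exists_hexRel_of_hexRel_map f v hv with ⟨u, hu⟩ | ⟨x, hx⟩ | ⟨x, hx⟩
    · have hU : IsHexagon {w | hexRel u w} := ⟨u, rfl⟩
      have hc : hexRel u hU.choose :=
        hU.choose_spec.symm.subset (hexRel_refl hU.choose)
      exact ⟨Sum.inl ⟨_, hU⟩, (setOf_hexRel_eq (hexRel_trans hu (hexRel_coe hc))).symm⟩
    · exact ⟨Sum.inr (Sum.inl x), (setOf_hexRel_eq hx).symm⟩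
    · exact ⟨Sum.inr (Sum.inr x), (setOf_hexRel_eq hx).symm⟩
  have hcard := (Nat.card_mono (Set.toFinite _) hΦ).trans (Finite.card_range_le Φ)
  rw [Nat.card_sum, Nat.card_sum, Nat.card_eq_fintype_card (α := G)] at hcard
  refine hcard.trans ?_
  unfold numHexagons
  lia
end

section
/- Let G be a finite abelian group of order n and let ε ∈ G satisfy ε² = 1. Then the number of symmetric subsets S ⊆ G³ such that (ε, x, 1) ∈ S for every x ∈ G is at most 2^{−n/6}·2^{h(G)}. -/
/-- At most six triples `(ε, x, 1)` lie in the same hexagon. -/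
theorem card_le_six_mul_card_hexagons {G : Type*} [CommGroup G] [Fintype G] (ε : G) :
    Fintype.card G ≤ 6 * Nat.card (Set.range fun x : G => hexagonOf (ε, x, 1)) := by
  classical
  rw [Nat.card_coe_set_eq, ← Set.image_univ, ← Finset.coe_univ, ← Finset.coe_image,
    Set.ncard_coe_finset]
  refine Finset.card_le_mul_card_image _ 6 fun H hH => ?_
  obtain ⟨x, -, rfl⟩ := Finset.mem_image.mp hH
  refine (Finset.card_le_card (t := {x, 1 * x⁻¹, ε, x⁻¹ * ε, ε⁻¹, ε⁻¹ * x}) ?_).trans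
    Finset.card_le_six
  intro y hy
  have hxy : hexRel (ε, x, 1) (ε, y, 1) := by
    have h := congrArg Subtype.val (Finset.mem_filter.mp hy).2
    have hmem : (ε, y, 1) ∈ (hexagonOf (ε, y, 1)).1 := hexRel_refl _
    rwa [h] at hmem
  obtain ⟨g, h⟩ := hxy
  simp only [Prod.mk.injEq] at h
  simp only [Finset.mem_insert, Finset.mem_singleton]
  rcases h with ⟨-, h, e⟩ | ⟨-, h, e⟩ | ⟨-, h, e⟩ | ⟨-, h, e⟩ | ⟨-, h, e⟩ | ⟨-, h, e⟩ <;>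
    rw [eq_inv_of_mul_eq_one_left e.symm] at h <;> rw [h] <;> simp

/-- A symmetric set containing all triples `(ε, x, 1)` is determined by the other hexagons it
contains. -/
theorem card_symmetric_le {G : Type*} [CommGroup G] [Fintype G] (ε : G) :
    Nat.card {S : Set (G × G × G) // IsSymmetric S ∧ ∀ x : G, (ε, x, 1) ∈ S} ≤
      2 ^ Nat.card ↥(Set.range fun x : G => hexagonOf (ε, x, 1))ᶜ := by
  classical
  rw [← Nat.card_eq_fintype_card (α := Bool) |>.trans Fintype.card_bool, ← Nat.card_fun]
  refine Nat.card_le_card_of_injective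
    (fun S H => decide (H.1.1 ⊆ S.1)) fun S T hST => ?_
  have key : ∀ S T : {S : Set (G × G × G) // IsSymmetric S ∧ ∀ x : G, (ε, x, 1) ∈ S},
      (∀ H : ↥(Set.range fun x : G => hexagonOf (ε, x, 1))ᶜ, H.1.1 ⊆ S.1 → H.1.1 ⊆ T.1) →
      S.1 ⊆ T.1 := by
    intro S T h v hv
    by_cases hR : hexagonOf v ∈ Set.range fun x : G => hexagonOf (ε, x, 1)
    · obtain ⟨x, hx⟩ := hR
      have hmem : v ∈ (hexagonOf v).1 := hexRel_refl v
      rw [← hx] at hmem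
      exact T.2.1.mem_of_hexRel (T.2.2 x) hmem
    · exact h ⟨hexagonOf v, hR⟩ (fun w hw => S.2.1.mem_of_hexRel hv hw) (hexRel_refl v)
  have hiff := fun H => decide_eq_decide.mp (congrFun hST H)
  exact Subtype.ext ((key S T fun H => (hiff H).1).antisymm (key T S fun H => (hiff H).2))

/-- for a finite abelian group `G` of order `n` and `ε ∈ G` with `ε² = 1`,
the number of symmetric subsets `S ⊆ G³` with `(ε, x, 1) ∈ S` for all `x ∈ G` is at most
`2^{-n/6} · 2^{h(G)}`. -/
theorem stmt10 (G : Type*) [CommGroup G] [Fintype G] (ε : G) (hε : ε ^ 2 = 1) :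
    (Nat.card {S : Set (G × G × G) // IsSymmetric S ∧ ∀ x : G, (ε, x, 1) ∈ S} : ℝ) ≤
      (2 : ℝ) ^ (-((Fintype.card G : ℝ) / 6)) * 2 ^ numHexagons G := by
  have hcard := card_le_six_mul_card_hexagons ε
  have hsum := Set.ncard_add_ncard_compl (Set.range fun x : G => hexagonOf (ε, x, 1))
  simp only [← Nat.card_coe_set_eq] at hsum
  have hcard' : (Fintype.card G : ℝ) ≤
      6 * Nat.card (Set.range fun x : G => hexagonOf (ε, x, 1)) := by exact_mod_cast hcard
  calc (Nat.card {S : Set (G × G × G) // IsSymmetric S ∧ ∀ x : G, (ε, x, 1) ∈ S} : ℝ)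
      ≤ 2 ^ Nat.card ↥(Set.range fun x : G => hexagonOf (ε, x, 1))ᶜ := by
        exact_mod_cast card_symmetric_le ε
    _ ≤ (2 : ℝ) ^ (-((Fintype.card G : ℝ) / 6)) * 2 ^ numHexagons G := by
        rw [numHexagons, ← hsum, ← Real.rpow_natCast, ← Real.rpow_natCast,
          ← Real.rpow_add two_pos]
        refine Real.rpow_le_rpow_of_exponent_le one_le_two ?_
        push_cast
        linarith
end

section
/- Let G be a finite abelian group of order n, let ε ∈ G satisfy ε² = 1, and let S ⊆ G³ be a symmetric subset satisfying condition (A) with respect to ε. Then S contains at least (n−1)/6 hexagons; that is, 6 times the number of hexagons contained in S is at least n − 1. -/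
/-- Condition (A) w.r.t. `ε`: every `x ≠ ε` lies in some fundamental pair. -/
def CondA {G : Type*} [CommGroup G] (ε : G) (S : Set (G × G × G)) : Prop :=
  ∀ x : G, x ≠ ε → ∃ y : G, (x, y, 1) ∈ S

/-- The ratios of two distinct coordinates of a triple. -/
def tripleRatios {G : Type*} [CommGroup G] [DecidableEq G] (v : G × G × G) : Finset G :=
  {v.1 / v.2.2, v.1 / v.2.1, v.2.1 / v.2.2, v.2.1 / v.1, v.2.2 / v.1, v.2.2 / v.2.1}

theorem card_tripleRatios_le {G : Type*} [CommGroup G] [DecidableEq G] (v : G × G × G) :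
    (tripleRatios v).card ≤ 6 :=
  Finset.card_le_six

theorem mem_tripleRatios_of_hexRel {G : Type*} [CommGroup G] [DecidableEq G] {v : G × G × G}
    {x y : G} (h : hexRel v (x, y, 1)) : x ∈ tripleRatios v := by
  have key : ∀ g a c : G, x = g * a → 1 = g * c → x = a / c := by
    intro g a c hx hc
    rw [hx, eq_inv_of_mul_eq_one_left hc.symm, mul_comm, div_eq_mul_inv]
  obtain ⟨g, h⟩ := h
  simp only [Prod.mk.injEq] at h
  simp only [tripleRatios, Finset.mem_insert, Finset.mem_singleton]
  rcases h with ⟨h, _, k⟩ | ⟨h, _, k⟩ | ⟨h, _, k⟩ | ⟨h, _, k⟩ | ⟨h, _, k⟩ | ⟨h, _, k⟩ <;>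
    simp [key g _ _ h k]

/-- a symmetric subset `S ⊆ G³` satisfying condition (A) w.r.t. `ε`
contains at least `(n-1)/6` hexagons. -/
theorem stmt11 (G : Type*) [CommGroup G] [Fintype G] (ε : G) (hε : ε ^ 2 = 1)
    (S : Set (G × G × G)) (hS : IsSymmetric S) (hA : CondA ε S) :
    Fintype.card G - 1 ≤
      6 * Nat.card {H : Set (G × G × G) // IsHexagon H ∧ H ⊆ S} := by
  classical
  choose y hy using hA
  let hex : {x : G // x ≠ ε} → {H : Set (G × G × G) // IsHexagon H ∧ H ⊆ S} := fun x =>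
    ⟨{w | hexRel (x.1, y x.1 x.2, 1) w}, ⟨_, rfl⟩, fun _ hw => hS.mem_of_hexRel (hy x.1 x.2) hw⟩
  have fiber_le : ∀ H ∈ (Finset.univ : Finset {H : Set (G × G × G) // IsHexagon H ∧ H ⊆ S}),
      (Finset.univ.filter fun x => hex x = H).card ≤ 6 := by
    rintro ⟨H, ⟨v, rfl⟩, hH⟩ -
    refine (Finset.card_le_card_of_injOn Subtype.val ?_ Subtype.val_injective.injOn).trans
      (card_tripleRatios_le v)
    intro x hx
    have hx : hex x = _ := (Finset.mem_filter.mp hx).2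
    have mem : (x.1, y x.1 x.2, 1) ∈ (hex x).1 := hexRel_refl _
    rw [hx] at mem
    exact mem_tripleRatios_of_hexRel mem
  have := Finset.card_le_mul_card_image_of_maps_to
    (fun x _ => Finset.mem_univ (hex x)) 6 fiber_le
  rw [Finset.card_univ, Finset.card_univ, Fintype.card_subtype_compl,
    Fintype.card_subtype_eq] at this
  rwa [Nat.card_eq_fintype_card]
end

section
/- Let G be a finite abelian group of order n ≥ 2 and let ε ∈ G satisfy ε² = 1. Then the number of symmetric subsets S ⊆ G³ for which condition (A) fails — i.e., for which there exists g ∈ G with g ≠ ε such that (g, y, 1) ∉ S for all y ∈ G — is at least 2^{h(G) − n}. -/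
theorem hexagonOf_surjective {G : Type*} [CommGroup G] :
    Function.Surjective (hexagonOf (G := G)) := by
  rintro ⟨_, v, rfl⟩
  exact ⟨v, rfl⟩

theorem hexagonOf_swap {G : Type*} [CommGroup G] (x y z : G) :
    hexagonOf (y, x, z) = hexagonOf (x, y, z) := by
  refine Subtype.ext (Set.ext fun w => ?_)
  exact exists_congr fun g => by dsimp only; tauto

theorem hexagonOf_rotate {G : Type*} [CommGroup G] (x y z : G) :
    hexagonOf (y, z, x) = hexagonOf (x, y, z) := by
  refine Subtype.ext (Set.ext fun w => ?_)
  exact exists_congr fun g => by dsimp only; tauto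

theorem hexagonOf_mul {G : Type*} [CommGroup G] (g x y z : G) :
    hexagonOf (g * x, g * y, g * z) = hexagonOf (x, y, z) := by
  refine Subtype.ext (Set.ext fun w => ?_)
  refine (Equiv.mulRight g).exists_congr fun a => ?_
  simp only [Equiv.coe_mulRight, mul_assoc]

/-- The union of any family of hexagons is symmetric. -/
theorem isSymmetric_preimage_hexagonOf {G : Type*} [CommGroup G]
    (T : Set {H : Set (G × G × G) // IsHexagon H}) : IsSymmetric (hexagonOf ⁻¹' T) := by
  refine ⟨fun x y z h => ?_, fun x y z h => ?_, fun g x y z h => ?_⟩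
  · rwa [Set.mem_preimage, hexagonOf_swap]
  · rwa [Set.mem_preimage, hexagonOf_rotate]
  · rwa [Set.mem_preimage, hexagonOf_mul]

/-- for a finite abelian group `G` of order `n ≥ 2` and `ε ∈ G` with
`ε² = 1`, the number of symmetric subsets for which condition (A) fails is at least
`2^{h(G) - n}`. -/
theorem stmt12 (G : Type*) [CommGroup G] [Fintype G] (hG : 2 ≤ Fintype.card G)
    (ε : G) (hε : ε ^ 2 = 1) :
    (2 : ℝ) ^ ((numHexagons G : ℤ) - (Fintype.card G : ℤ)) ≤
      (Nat.card {S : Set (G × G × G) // IsSymmetric S ∧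
        ∃ g : G, g ≠ ε ∧ ∀ y : G, (g, y, 1) ∉ S} : ℝ) := by
  classical
  have : Nontrivial G := Fintype.one_lt_card_iff_nontrivial.mp hG
  obtain ⟨g, hg⟩ := exists_ne ε
  let B : Set {H : Set (G × G × G) // IsHexagon H} :=
    Set.range fun y : G => hexagonOf (g, y, 1)
  have hB : B.ncard ≤ Fintype.card G := by
    rw [← Nat.card_coe_set_eq, ← Nat.card_eq_fintype_card]
    exact Finite.card_range_le _
  let F : Set ↥Bᶜ → {S : Set (G × G × G) // IsSymmetric S ∧
      ∃ g : G, g ≠ ε ∧ ∀ y : G, (g, y, 1) ∉ S} := fun T =>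
    ⟨hexagonOf ⁻¹' (Subtype.val '' T), isSymmetric_preimage_hexagonOf _, g, hg, by
      rintro y ⟨H, -, hH⟩
      exact H.2 ⟨y, hH.symm⟩⟩
  have hF : Function.Injective F := fun S T h =>
    Subtype.val_injective.image_injective
      (hexagonOf_surjective.preimage_injective (congrArg Subtype.val h))
  have hcard : 2 ^ Bᶜ.ncard ≤ Nat.card {S : Set (G × G × G) // IsSymmetric S ∧
      ∃ g : G, g ≠ ε ∧ ∀ y : G, (g, y, 1) ∉ S} := by
    have h := Nat.card_le_card_of_injective F hF
    rwa [Nat.card_eq_fintype_card, Fintype.card_set, ← Nat.card_eq_fintype_card,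
      Nat.card_coe_set_eq] at h
  have hsum : B.ncard + Bᶜ.ncard = numHexagons G := Set.ncard_add_ncard_compl B
  calc (2 : ℝ) ^ ((numHexagons G : ℤ) - (Fintype.card G : ℤ))
      ≤ (2 : ℝ) ^ (Bᶜ.ncard : ℤ) := zpow_le_zpow_right₀ one_le_two (by omega)
    _ ≤ _ := by rw [zpow_natCast]; exact_mod_cast hcard
end

section
/- Let G be an abelian group, let ε ∈ G satisfy ε² = 1, and let S ⊆ G³ be a symmetric subset satisfying condition (⋆). Then for every x ∈ G (including x = ε) there exists y ∈ G with (x, y, 1) ∈ S, and S satisfies condition (B) with respect to ε; in particular S is hyperfield-defining with respect to ε. -/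
/-- Condition (B) w.r.t. `ε`. -/
def CondB {G : Type*} [CommGroup G] (ε : G) (S : Set (G × G × G)) : Prop :=
  ∀ x y z w : G, (x, y, 1) ∈ S → (z, w, 1) ∈ S → (x, y) ≠ (z, w) →
    ∃ t : G, (t * x, ε * t * z, 1) ∈ S ∧ (ε * t * y, t * w, 1) ∈ S

/-- if a symmetric subset `S` of `G³` (G abelian, `ε² = 1`) satisfies
condition (⋆), then every `x ∈ G` (including `x = ε`) lies in some fundamental pair, and
`S` satisfies condition (B); in particular `S` is hyperfield-defining (satisfies (A) and
(B)) with respect to `ε`. -/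
theorem stmt13 (G : Type*) [CommGroup G] (ε : G) (hε : ε ^ 2 = 1)
    (S : Set (G × G × G)) (hS : IsSymmetric S) (hstar : CondStar S) :
    (∀ x : G, ∃ y : G, (x, y, 1) ∈ S) ∧ CondB ε S ∧ (CondA ε S ∧ CondB ε S) := by
  have hA : ∀ x : G, ∃ y : G, (x, y, 1) ∈ S := by
    intro x
    obtain ⟨t, ht, -⟩ := hstar x 1 x 1
    have h := hS.2.2 t⁻¹ _ _ _ ht
    simp only [mul_one, inv_mul_cancel, inv_mul_cancel_left] at h
    exact ⟨t⁻¹, hS.2.1 _ _ _ (hS.1 _ _ _ h)⟩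
  have hB : CondB ε S := by
    intro x y z w _ _ _
    obtain ⟨t, h₁, h₂⟩ := hstar x (ε * z) (ε * y) w
    refine ⟨t, ?_, ?_⟩
    · rwa [mul_comm ε t, mul_assoc]
    · rwa [mul_comm ε t, mul_assoc]
  exact ⟨hA, hB, fun x _ => hA x, hB⟩
end

section
/- Let G be an abelian group, let ε ∈ G satisfy ε² = 1, and let S ⊆ G³ be a symmetric subset. On the set Ĝ = G ⊔ {0}, define a multivalued addition ⊞ by: x ⊞ 0 = 0 ⊞ x = {x} for all x ∈ Ĝ, and for x, y ∈ G, x ⊞ y = {z ∈ G : (x, y, εz) ∈ S}, augmented by the extra element 0 exactly when x = εy. Extend ⊞ to subsets of Ĝ by A ⊞ B = ⋃_{a ∈ A, b ∈ B} a ⊞ b. Then ⊞ is associative — i.e., (a ⊞ b) ⊞ c = a ⊞ (b ⊞ c) for all a, b, c ∈ Ĝ — if and only if S satisfies conditions (A) and (B) with respect to ε. -/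
open Classical in
/-- The multivalued addition on `Ĝ = G ⊔ {0} = WithZero G` determined by `ε` and the
symmetric subset `S`: `x ⊞ 0 = 0 ⊞ x = {x}`, and for `x, y ∈ G`,
`x ⊞ y = {z ∈ G : (x, y, εz) ∈ S}`, augmented by `0` exactly when `x = εy`. -/
noncomputable def hAdd {G : Type*} [CommGroup G] (ε : G) (S : Set (G × G × G))
    (a b : WithZero G) : Set (WithZero G) :=
  if a = 0 then {b}
  else if b = 0 then {a}
  else
    {c : WithZero G | ∃ x y z : G, a = (x : WithZero G) ∧ b = (y : WithZero G) ∧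
        c = (z : WithZero G) ∧ (x, y, ε * z) ∈ S} ∪
      {c : WithZero G | c = 0 ∧ ∃ x y : G, a = (x : WithZero G) ∧ b = (y : WithZero G) ∧
        x = ε * y}

/-- Extension of the multivalued addition to subsets of `Ĝ`. -/
noncomputable def hAddSet {G : Type*} [CommGroup G] (ε : G) (S : Set (G × G × G))
    (A B : Set (WithZero G)) : Set (WithZero G) :=
  ⋃ a ∈ A, ⋃ b ∈ B, hAdd ε S a b

theorem mem_hAddSet {G : Type*} [CommGroup G] (ε : G) (S : Set (G × G × G))
    (A B : Set (WithZero G)) (d : WithZero G) :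
    d ∈ hAddSet ε S A B ↔ ∃ a ∈ A, ∃ b ∈ B, d ∈ hAdd ε S a b := by
  simp [hAddSet]

theorem zero_hAdd {G : Type*} [CommGroup G] (ε : G) (S : Set (G × G × G)) (b : WithZero G) :
    hAdd ε S 0 b = {b} := by
  simp [hAdd]

theorem hAdd_zero {G : Type*} [CommGroup G] (ε : G) (S : Set (G × G × G)) (a : WithZero G) :
    hAdd ε S a 0 = {a} := by
  by_cases h : a = 0 <;> simp [hAdd, h]

theorem coe_mem_hAdd_coe {G : Type*} [CommGroup G] (ε : G) (S : Set (G × G × G)) (x y z : G) :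
    (z : WithZero G) ∈ hAdd ε S x y ↔ (x, y, ε * z) ∈ S := by
  simp [hAdd]

theorem zero_mem_hAdd_coe {G : Type*} [CommGroup G] (ε : G) (S : Set (G × G × G)) (x y : G) :
    (0 : WithZero G) ∈ hAdd ε S x y ↔ x = ε * y := by
  simp [hAdd, -WithZero.coe_mul]

theorem WithZero.exists_iff_zero_or_coe {G : Type*} {p : WithZero G → Prop} :
    (∃ a, p a) ↔ p 0 ∨ ∃ g : G, p g :=
  Option.exists

/-- `d ∈ (a ⊞ b) ⊞ c`, for elements of `G`. -/
def MemAddAdd {G : Type*} [CommGroup G] (ε : G) (S : Set (G × G × G)) (a b c d : G) : Prop :=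
  (∃ e : G, (a, b, ε * e) ∈ S ∧ (e, c, ε * d) ∈ S) ∨ (a = ε * b ∧ d = c)

theorem coe_mem_hAddSet_left {G : Type*} [CommGroup G] (ε : G) (S : Set (G × G × G))
    (a b c d : G) :
    (d : WithZero G) ∈ hAddSet ε S (hAdd ε S a b) {(c : WithZero G)} ↔ MemAddAdd ε S a b c d := by
  simp only [mem_hAddSet, WithZero.exists_iff_zero_or_coe (p := fun e => e ∈ hAdd ε S a b ∧ _),
    Set.mem_singleton_iff, exists_eq_left, zero_hAdd, coe_mem_hAdd_coe, zero_mem_hAdd_coe,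
    WithZero.coe_inj, MemAddAdd]
  exact or_comm

theorem zero_mem_hAddSet_left {G : Type*} [CommGroup G] {ε : G} (hε : ε * ε = 1)
    (S : Set (G × G × G)) (a b c : G) :
    (0 : WithZero G) ∈ hAddSet ε S (hAdd ε S a b) {(c : WithZero G)} ↔ (a, b, c) ∈ S := by
  simp [mem_hAddSet, WithZero.exists_iff_zero_or_coe (p := fun e => e ∈ hAdd ε S a b ∧ _),
    zero_hAdd, coe_mem_hAdd_coe, zero_mem_hAdd_coe, ← mul_assoc, hε]

namespace IsSymmetric

variable {G : Type*} [CommGroup G] {S : Set (G × G × G)}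

theorem swap_iff (hS : IsSymmetric S) (x y z : G) : (x, y, z) ∈ S ↔ (y, x, z) ∈ S :=
  ⟨hS.1 _ _ _, hS.1 _ _ _⟩

theorem cycle_iff (hS : IsSymmetric S) (x y z : G) : (x, y, z) ∈ S ↔ (y, z, x) ∈ S :=
  ⟨hS.2.1 _ _ _, fun h => hS.2.1 _ _ _ (hS.2.1 _ _ _ h)⟩

theorem reverse_iff (hS : IsSymmetric S) (x y z : G) : (x, y, z) ∈ S ↔ (z, y, x) ∈ S := by
  rw [hS.cycle_iff, hS.swap_iff]

/-- Membership up to a scaling, with the scaled coordinates given by equations. -/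
theorem smul_mem (hS : IsSymmetric S) (g : G) {x y z x' y' z' : G} (h : (x, y, z) ∈ S)
    (hx : g * x = x') (hy : g * y = y') (hz : g * z = z') : (x', y', z') ∈ S := by
  subst hx hy hz
  exact hS.2.2 g _ _ _ h

theorem hAdd_comm (hS : IsSymmetric S) {ε : G} (hε : ε * ε = 1) (a b : WithZero G) :
    hAdd ε S a b = hAdd ε S b a := by
  induction a using WithZero.recZeroCoe with
  | zero => rw [zero_hAdd, hAdd_zero]
  | coe a =>
    induction b using WithZero.recZeroCoe with
    | zero => rw [zero_hAdd, hAdd_zero]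
    | coe b =>
      ext d
      induction d using WithZero.recZeroCoe with
      | zero =>
        simp only [zero_mem_hAdd_coe]
        constructor <;> rintro rfl <;> simp [← mul_assoc, hε]
      | coe d => simp only [coe_mem_hAdd_coe, hS.swap_iff]

theorem hAddSet_comm (hS : IsSymmetric S) {ε : G} (hε : ε * ε = 1) (A B : Set (WithZero G)) :
    hAddSet ε S A B = hAddSet ε S B A := by
  ext d
  simp only [mem_hAddSet]
  constructor <;> rintro ⟨a, ha, b, hb, hd⟩ <;>
    exact ⟨b, hb, a, ha, hS.hAdd_comm hε a b ▸ hd⟩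

/-- By commutativity, associativity amounts to the invariance of `(a ⊞ b) ⊞ c` under exchanging
`a` and `c`. -/
theorem assoc_iff (hS : IsSymmetric S) {ε : G} (hε : ε * ε = 1) :
    (∀ a b c : WithZero G,
        hAddSet ε S (hAdd ε S a b) {c} = hAddSet ε S {a} (hAdd ε S b c)) ↔
      ∀ a b c d : G, MemAddAdd ε S a b c d → MemAddAdd ε S c b a d := by
  have hright (a b c : WithZero G) :
      hAddSet ε S {a} (hAdd ε S b c) = hAddSet ε S (hAdd ε S c b) {a} := by
    rw [hS.hAddSet_comm hε, hS.hAdd_comm hε b c]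
  constructor
  · intro h a b c d hd
    rwa [← coe_mem_hAddSet_left, ← hright, ← h, coe_mem_hAddSet_left]
  · intro h a b c
    induction a using WithZero.recZeroCoe with
    | zero => simp [hAddSet, zero_hAdd]
    | coe a =>
      induction b using WithZero.recZeroCoe with
      | zero => simp [hAddSet, zero_hAdd, hAdd_zero]
      | coe b =>
        induction c using WithZero.recZeroCoe with
        | zero => simp [hAddSet, hAdd_zero]
        | coe c =>
          rw [hright]
          ext d
          induction d using WithZero.recZeroCoe with
          | zero => rw [zero_mem_hAddSet_left hε, zero_mem_hAddSet_left hε, hS.reverse_iff]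
          | coe d =>
            rw [coe_mem_hAddSet_left, coe_mem_hAddSet_left]
            exact ⟨h a b c d, h c b a d⟩

theorem condA_of_memAddAdd (hS : IsSymmetric S) {ε : G} (hε : ε * ε = 1)
    (h : ∀ a b c d : G, MemAddAdd ε S a b c d → MemAddAdd ε S c b a d) : CondA ε S := by
  intro x hx
  rcases h (ε * x) x 1 1 (.inr ⟨rfl, rfl⟩) with ⟨e, he, -⟩ | ⟨h1, h2⟩
  · exact ⟨ε * e, (hS.cycle_iff _ _ _).1 he⟩
  · exact absurd (mul_left_cancel (h1.symm.trans hε.symm)) hx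

theorem condB_of_memAddAdd (hS : IsSymmetric S) {ε : G} (hε : ε * ε = 1)
    (h : ∀ a b c d : G, MemAddAdd ε S a b c d → MemAddAdd ε S c b a d) : CondB ε S := by
  intro x y z w hxy hzw hne
  have hzw' : (ε, ε * w, ε * z) ∈ S :=
    (hS.reverse_iff _ _ _).1 (hS.smul_mem ε hzw rfl rfl (mul_one ε))
  rcases h x y (ε * w) z (.inl ⟨ε, by rwa [hε], hzw'⟩) with ⟨f, hf₁, hf₂⟩ | ⟨h1, h2⟩
  · refine ⟨f⁻¹, hS.smul_mem f⁻¹ ((hS.cycle_iff _ _ _).1 hf₂) rfl ?_ (inv_mul_cancel f),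
      hS.smul_mem (ε * f⁻¹) ((hS.swap_iff _ _ _).1 hf₁) rfl ?_ ?_⟩
    · rw [← mul_assoc, mul_comm f⁻¹]
    · rw [mul_mul_mul_comm, hε, one_mul]
    · rw [mul_mul_mul_comm, hε, inv_mul_cancel, one_mul]
  · exact absurd (Prod.ext h2.symm (mul_left_cancel h1).symm) hne

theorem memAddAdd_of_cond (hS : IsSymmetric S) {ε : G} (hε : ε * ε = 1)
    (hA : CondA ε S) (hB : CondB ε S) (a b c d : G) (h : MemAddAdd ε S a b c d) :
    MemAddAdd ε S c b a d := by
  have hεε (x : G) : ε * (ε * x) = x := by rw [← mul_assoc, hε, one_mul]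
  have hinv : ε⁻¹ = ε := inv_eq_of_mul_eq_one_left hε
  by_cases htriv : c = ε * b ∧ d = a
  · exact .inr htriv
  refine .inl ?_
  rcases h with ⟨e, he₁, he₂⟩ | ⟨rfl, rfl⟩
  · have h₁ : (ε * e⁻¹ * a, ε * e⁻¹ * b, 1) ∈ S :=
      hS.smul_mem (ε * e⁻¹) he₁ rfl rfl (by rw [mul_mul_mul_comm, hε, inv_mul_cancel, one_mul])
    have h₂ : (e⁻¹ * (ε * d), e⁻¹ * c, 1) ∈ S :=
      hS.smul_mem e⁻¹ ((hS.reverse_iff _ _ _).1 he₂) rfl rfl (inv_mul_cancel e)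
    have hne : (ε * e⁻¹ * a, ε * e⁻¹ * b) ≠ (e⁻¹ * (ε * d), e⁻¹ * c) := by
      intro heq
      obtain ⟨h3, h4⟩ := Prod.ext_iff.1 heq
      simp only [mul_comm ε e⁻¹, mul_assoc, mul_right_inj] at h3 h4
      exact htriv ⟨h4.symm, h3.symm⟩
    obtain ⟨t, ht₁, ht₂⟩ := hB _ _ _ _ h₁ h₂ hne
    refine ⟨ε * (e * t⁻¹), hS.smul_mem (e * t⁻¹) ((hS.swap_iff _ _ _).1 ht₂) ?_ ?_ ?_,
      hS.smul_mem (ε * (e * t⁻¹)) (hS.2.1 _ _ _ (hS.2.1 _ _ _ ht₁)) (mul_one _) ?_ ?_⟩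
    · simp [mul_assoc, mul_comm, mul_left_comm]
    · simp [mul_assoc, mul_comm, mul_left_comm, hεε]
    · simp [hεε]
    · simp [mul_assoc, mul_comm, mul_left_comm, hεε]
    · simp [mul_assoc, mul_comm, mul_left_comm, hεε]
  · have hx : b * d⁻¹ ≠ ε := by
      intro hb
      rw [mul_inv_eq_iff_eq_mul] at hb
      exact htriv ⟨by rw [hb, hεε], by rw [hb, hεε]⟩
    obtain ⟨y, hy⟩ := hA _ hx
    have hy' : (b, d * y, d) ∈ S := hS.smul_mem d hy (by simp) rfl (mul_one d)
    refine ⟨ε * (d * y), ?_, ?_⟩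
    · rw [hεε]
      exact hS.2.1 _ _ _ (hS.2.1 _ _ _ hy')
    · exact hS.smul_mem ε (hS.1 _ _ _ hy') rfl rfl rfl

end IsSymmetric

/-- the multivalued addition `⊞` determined by a symmetric subset
`S ⊆ G³` and `ε` (with `ε² = 1`) is associative if and only if `S` satisfies conditions
(A) and (B) with respect to `ε`. -/
theorem stmt14 (G : Type*) [CommGroup G] (ε : G) (hε : ε ^ 2 = 1)
    (S : Set (G × G × G)) (hS : IsSymmetric S) :
    (∀ a b c : WithZero G,
        hAddSet ε S (hAdd ε S a b) {c} = hAddSet ε S {a} (hAdd ε S b c)) ↔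
      (CondA ε S ∧ CondB ε S) := by
  have hεε : ε * ε = 1 := by rwa [← sq]
  rw [hS.assoc_iff hεε]
  exact ⟨fun h => ⟨hS.condA_of_memAddAdd hεε h, hS.condB_of_memAddAdd hεε h⟩,
    fun h => hS.memAddAdd_of_cond hεε h.1 h.2⟩
end
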